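/- arXiv:2112.10169 — 4 statements merged into one kernel-verified Lean document; each statement's English description precedes it below -/
import Mathlib

section
/- Let K be a singular kernel function, n ∈ ℕ, r₁,…,rₙ > 0, and J an arbitrary n-field function. Then for each j ∈ {0,1,…,n} the interval maximum function mⱼ : S̄ → ℝ ∪ {−∞} is continuous in the extended sense (with respect to the order topology on ℝ ∪ {−∞}). Moreover m̄ : S̄ → ℝ ∪ {−∞} and m̲ : S̄ → ℝ ∪ {−∞} are continuous in the extended sense, and m̄ never takes the value −∞, hence is continuous as a real-valued function. -/
open Set Filter

noncomputable section

/-- A kernel function: `ℝ ∪ {−∞}`-valued (modeled as `EReal`, never `⊤`),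
finite and concave on `(-1,0)` and `(0,1)`, extended continuously to `[-1,1]`. -/
structure IsKernel (K : ℝ → EReal) : Prop where
  ne_top : ∀ t, K t ≠ ⊤
  finite_off_zero : ∀ t ∈ Ioo (-1:ℝ) 1, t ≠ 0 → K t ≠ ⊥
  concave_neg : ConcaveOn ℝ (Ioo (-1:ℝ) 0) (fun t => (K t).toReal)
  concave_pos : ConcaveOn ℝ (Ioo (0:ℝ) 1) (fun t => (K t).toReal)
  lim_zero_left : Tendsto K (nhdsWithin 0 (Iio 0)) (nhds (K 0))
  lim_zero_right : Tendsto K (nhdsWithin 0 (Ioi 0)) (nhds (K 0))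
  lim_neg_one : Tendsto K (nhdsWithin (-1) (Ioi (-1))) (nhds (K (-1)))
  lim_one : Tendsto K (nhdsWithin 1 (Iio 1)) (nhds (K 1))

/-- Singularity condition `(∞)`: `K(0) = −∞`. -/
def SingularKernel (K : ℝ → EReal) : Prop := K 0 = ⊥

/-- Monotonicity condition (M). -/
def MonotoneKernel (K : ℝ → EReal) : Prop :=
  AntitoneOn K (Ioo (-1:ℝ) 0) ∧ MonotoneOn K (Ioo (0:ℝ) 1)

/-- Strict monotonicity condition (SM). -/
def StrictMonotoneKernel (K : ℝ → EReal) : Prop :=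
  StrictAntiOn K (Ico (-1:ℝ) 0) ∧ StrictMonoOn K (Ioc (0:ℝ) 1)

/-- Strict concavity of a kernel function. -/
def StrictConcaveKernel (K : ℝ → EReal) : Prop :=
  StrictConcaveOn ℝ (Ioo (-1:ℝ) 0) (fun t => (K t).toReal) ∧
  StrictConcaveOn ℝ (Ioo (0:ℝ) 1) (fun t => (K t).toReal)

/-- An `n`-field function: bounded above, never `+∞`, finite on a set of weighted
cardinality exceeding `n` (interior points of `[0,1]` count `1`, the endpoints `1/2`). -/
def IsFieldFn (n : ℕ) (J : ℝ → EReal) : Prop :=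
  (∀ t, J t ≠ ⊤) ∧ (∃ M : ℝ, ∀ t ∈ Icc (0:ℝ) 1, J t ≤ (M : EReal)) ∧
  ∃ T : Finset ℝ, (T : Set ℝ) ⊆ Icc (0:ℝ) 1 ∧ (∀ t ∈ T, J t ≠ ⊥) ∧
    (n : ℝ) < ∑ t ∈ T, (if t = 0 ∨ t = 1 then (1/2 : ℝ) else 1)

/-- The closed simplex `S̄`. -/
def closedSimplex (n : ℕ) : Set (Fin n → ℝ) :=
  {y | Monotone y ∧ ∀ j, y j ∈ Icc (0:ℝ) 1}

/-- The open simplex `S`. -/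
def openSimplex (n : ℕ) : Set (Fin n → ℝ) :=
  {y | StrictMono y ∧ ∀ j, y j ∈ Ioo (0:ℝ) 1}

/-- Extended nodes: `y₀ = 0`, `y_{n+1} = 1`. -/
def extNode {n : ℕ} (y : Fin n → ℝ) (j : Fin (n + 2)) : ℝ :=
  if _h0 : (j : ℕ) = 0 then 0
  else if _hn : (j : ℕ) ≤ n then y ⟨(j : ℕ) - 1, by omega⟩
  else 1

/-- The interval `I_j(y) = [y_j, y_{j+1}]`, `j = 0, …, n`. -/
def nodeInterval {n : ℕ} (y : Fin n → ℝ) (j : Fin (n + 1)) : Set ℝ :=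
  Icc (extNode y j.castSucc) (extNode y j.succ)

/-- The sum of translates function `F(y,t) = J(t) + ∑ⱼ rⱼ K(t - yⱼ)`. -/
def sumTrans {n : ℕ} (r : Fin n → ℝ) (K J : ℝ → EReal) (y : Fin n → ℝ) (t : ℝ) : EReal :=
  J t + ∑ j, (r j : EReal) * K (t - y j)

/-- The interval maximum `m_j(y) = sup_{t ∈ I_j(y)} F(y,t)`. -/
def mj {n : ℕ} (r : Fin n → ℝ) (K J : ℝ → EReal) (j : Fin (n + 1)) (y : Fin n → ℝ) : EReal :=
  sSup (sumTrans r K J y '' nodeInterval y j)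

/-- `m̄(y) = max_j m_j(y)`. -/
def mbar {n : ℕ} (r : Fin n → ℝ) (K J : ℝ → EReal) (y : Fin n → ℝ) : EReal :=
  ⨆ j, mj r K J j y

/-- `m̲(y) = min_j m_j(y)`. -/
def munder {n : ℕ} (r : Fin n → ℝ) (K J : ℝ → EReal) (y : Fin n → ℝ) : EReal :=
  ⨅ j, mj r K J j y

/-- The regularity set `Y`. -/
def regSet {n : ℕ} (r : Fin n → ℝ) (K J : ℝ → EReal) : Set (Fin n → ℝ) :=
  {y ∈ openSimplex n | ∀ j, mj r K J j y ≠ ⊥}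

/-- Equioscillation: all interval maxima agree. -/
def Equioscillation {n : ℕ} (r : Fin n → ℝ) (K J : ℝ → EReal) (y : Fin n → ℝ) : Prop :=
  ∀ i j : Fin (n + 1), mj r K J i y = mj r K J j y

namespace EReal

lemma continuous_add_of_ne_top {X : Type*} [TopologicalSpace X] {f g : X → EReal}
    (hf : Continuous f) (hg : Continuous g) (hft : ∀ x, f x ≠ ⊤) (hgt : ∀ x, g x ≠ ⊤) :
    Continuous fun x => f x + g x :=
  continuous_iff_continuousAt.2 fun x =>
    (continuousAt_add (p := (f x, g x)) (.inl (hft x)) (.inr (hgt x))).comp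
      (f := fun x => (f x, g x)) (hf.prodMk hg).continuousAt

lemma sum_ne_top {ι : Type*} {s : Finset ι} {f : ι → EReal} (h : ∀ i ∈ s, f i ≠ ⊤) :
    ∑ i ∈ s, f i ≠ ⊤ :=
  Finset.sum_induction f (· ≠ ⊤) (fun _ _ => add_ne_top) zero_ne_top h

lemma sum_eq_bot_iff {ι : Type*} {s : Finset ι} {f : ι → EReal} :
    ∑ i ∈ s, f i = ⊥ ↔ ∃ i ∈ s, f i = ⊥ := by
  classical
  induction s using Finset.induction_on with
  | empty => simp
  | insert a s ha ih => simp [Finset.sum_insert ha, add_eq_bot_iff, ih]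

lemma continuous_sum_of_ne_top {X ι : Type*} [TopologicalSpace X] {s : Finset ι}
    {f : ι → X → EReal} (hf : ∀ i ∈ s, Continuous (f i)) (ht : ∀ i ∈ s, ∀ x, f i x ≠ ⊤) :
    Continuous fun x => ∑ i ∈ s, f i x := by
  classical
  induction s using Finset.induction_on with
  | empty => simpa using continuous_const
  | insert a s ha ih =>
    simp only [Finset.sum_insert ha]
    simp only [Finset.forall_mem_insert] at hf ht
    exact continuous_add_of_ne_top hf.1 (ih hf.2 ht.2) ht.1
      fun x => sum_ne_top fun i hi => ht.2 i hi x

lemma coe_mul_ne_top_of_pos {c : ℝ} (hc : 0 < c) {x : EReal} (hx : x ≠ ⊤) :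
    (c : EReal) * x ≠ ⊤ := by
  induction x with
  | bot => simp [coe_mul_bot_of_pos hc]
  | coe x => exact_mod_cast coe_ne_top (c * x)
  | top => exact absurd rfl hx

lemma coe_mul_eq_bot_iff_of_pos {c : ℝ} (hc : 0 < c) {x : EReal} :
    (c : EReal) * x = ⊥ ↔ x = ⊥ := by
  induction x with
  | bot => simp [coe_mul_bot_of_pos hc]
  | coe x => simpa using (by exact_mod_cast coe_ne_bot (c * x) : (c : EReal) * x ≠ ⊥)
  | top => simp [coe_mul_top_of_pos hc]

lemma continuous_coe_mul_of_pos {c : ℝ} (hc : 0 < c) : Continuous fun x : EReal => (c : EReal) * x :=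
  have hc' : (c : EReal) ≠ 0 := by exact_mod_cast hc.ne'
  continuous_iff_continuousAt.2 fun x =>
    (continuousAt_mul (p := ((c : EReal), x)) (.inl hc') (.inl hc') (.inl (by simp)) (.inl (by simp))).comp
      (f := fun x : EReal => ((c : EReal), x)) (continuous_const.prodMk continuous_id).continuousAt

end EReal

lemma continuousOn_Icc_of_concaveOn_Ioo {f : ℝ → EReal} {a b : ℝ} (hab : a < b)
    (htop : ∀ t, f t ≠ ⊤) (hbot : ∀ t ∈ Ioo a b, f t ≠ ⊥)
    (hconc : ConcaveOn ℝ (Ioo a b) fun t => (f t).toReal)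
    (ha : Tendsto f (nhdsWithin a (Ioi a)) (nhds (f a)))
    (hb : Tendsto f (nhdsWithin b (Iio b)) (nhds (f b))) : ContinuousOn f (Icc a b) := by
  have hc : ContinuousOn f (Ioo a b) :=
    (continuous_coe_real_ereal.comp_continuousOn (hconc.continuousOn isOpen_Ioo)).congr
      fun t ht => (EReal.coe_toReal (htop t) (hbot t ht)).symm
  intro t ht
  rcases ht.1.eq_or_lt with rfl | hat
  · exact (continuousWithinAt_Ioi_iff_Ici.1 ha).mono Icc_subset_Ici_self
  rcases ht.2.eq_or_lt with rfl | htb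
  · exact (continuousWithinAt_Iio_iff_Iic.1 hb).mono Icc_subset_Iic_self
  · exact (hc.continuousAt (isOpen_Ioo.mem_nhds ⟨hat, htb⟩)).continuousWithinAt

lemma IsKernel.continuousOn_right {K : ℝ → EReal} (hK : IsKernel K) :
    ContinuousOn K (Icc 0 1) :=
  continuousOn_Icc_of_concaveOn_Ioo one_pos hK.ne_top
    (fun t ht => hK.finite_off_zero t ⟨by linarith [ht.1], ht.2⟩ ht.1.ne')
    hK.concave_pos hK.lim_zero_right hK.lim_one

lemma IsKernel.continuousOn_left {K : ℝ → EReal} (hK : IsKernel K) :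
    ContinuousOn K (Icc (-1) 0) :=
  continuousOn_Icc_of_concaveOn_Ioo (by norm_num) hK.ne_top
    (fun t ht => hK.finite_off_zero t ⟨ht.1, by linarith [ht.2]⟩ ht.2.ne)
    hK.concave_neg hK.lim_neg_one hK.lim_zero_left

/-- The restriction of `K` to nonnegative arguments, set to `⊥` elsewhere. -/
def rightKernel (K : ℝ → EReal) (s : ℝ) : EReal :=
  if 0 ≤ s then K (max 0 (min s 1)) else ⊥

/-- The restriction of `K` to nonpositive arguments, set to `⊥` elsewhere. -/
def leftKernel (K : ℝ → EReal) (s : ℝ) : EReal :=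
  if s ≤ 0 then K (max (-1) (min s 0)) else ⊥

lemma continuous_rightKernel {K : ℝ → EReal} (hK : IsKernel K) (hsing : SingularKernel K) :
    Continuous (rightKernel K) := by
  refine Continuous.if_le (hK.continuousOn_right.comp_continuous (by fun_prop) fun s => ?_)
    continuous_const continuous_const continuous_id fun s hs => ?_
  · exact ⟨le_max_left _ _, max_le zero_le_one (min_le_right _ _)⟩
  · simpa [← hs] using show K 0 = ⊥ from hsing

lemma continuous_leftKernel {K : ℝ → EReal} (hK : IsKernel K) (hsing : SingularKernel K) :
    Continuous (leftKernel K) := by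
  refine Continuous.if_le (hK.continuousOn_left.comp_continuous (by fun_prop) fun s => ?_)
    continuous_const continuous_id continuous_const fun s hs => ?_
  · exact ⟨le_max_left _ _, max_le (by norm_num) (min_le_right _ _)⟩
  · have : s = 0 := hs
    simpa [this] using show K 0 = ⊥ from hsing

/-- The kernel through which node `i` acts on the interval `I_j`: the node lies to the left of
the interval precisely when `i < j`. -/
def sidedKernel {n : ℕ} (K : ℝ → EReal) (j : Fin (n + 1)) (i : Fin n) : ℝ → EReal :=
  if (i : ℕ) < j then rightKernel K else leftKernel K

/-- The sum of translates with the field value as a separate argument truncated at `M`, taken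
over the one-sided kernels, so that it equals `⊥` off the interval `I_j(y)`. -/
def sidedSum {n : ℕ} (r : Fin n → ℝ) (K : ℝ → EReal) (M : ℝ) (j : Fin (n + 1))
    (y : Fin n → ℝ) (p : ℝ × EReal) : EReal :=
  min p.2 M + ∑ i, (r i : EReal) * sidedKernel K j i (p.1 - y i)

lemma sidedKernel_ne_top {n : ℕ} {K : ℝ → EReal} (hK : IsKernel K) (j : Fin (n + 1)) (i : Fin n)
    (s : ℝ) : sidedKernel K j i s ≠ ⊤ := by
  unfold sidedKernel
  split_ifs
  · unfold rightKernel
    split_ifs <;> simp [hK.ne_top]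
  · unfold leftKernel
    split_ifs <;> simp [hK.ne_top]

lemma continuous_sidedKernel {n : ℕ} {K : ℝ → EReal} (hK : IsKernel K) (hsing : SingularKernel K)
    (j : Fin (n + 1)) (i : Fin n) : Continuous (sidedKernel K j i) := by
  unfold sidedKernel
  split_ifs
  exacts [continuous_rightKernel hK hsing, continuous_leftKernel hK hsing]

section

variable {n : ℕ} {r : Fin n → ℝ} {K J : ℝ → EReal} {M : ℝ}

lemma sidedSum_ne_top (hr : ∀ i, 0 < r i) (hK : IsKernel K) (j : Fin (n + 1)) (y : Fin n → ℝ)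
    (p : ℝ × EReal) : sidedSum r K M j y p ≠ ⊤ :=
  EReal.add_ne_top ((min_le_right _ _).trans_lt (EReal.coe_lt_top M)).ne
    (EReal.sum_ne_top fun i _ => EReal.coe_mul_ne_top_of_pos (hr i) (sidedKernel_ne_top hK j i _))

lemma continuous_sidedSum (hr : ∀ i, 0 < r i) (hK : IsKernel K) (hsing : SingularKernel K)
    (j : Fin (n + 1)) : Continuous ↿(sidedSum r K M j) := by
  have hne (i : Fin n) (s : ℝ) : (r i : EReal) * sidedKernel K j i s ≠ ⊤ :=
    EReal.coe_mul_ne_top_of_pos (hr i) (sidedKernel_ne_top hK j i s)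
  refine EReal.continuous_add_of_ne_top (f := fun q : (Fin n → ℝ) × ℝ × EReal => min q.2.2 M)
    (by fun_prop)
    (EReal.continuous_sum_of_ne_top (fun i _ => ?_) fun i _ q => hne i _)
    (fun q => ((min_le_right _ _).trans_lt (EReal.coe_lt_top M)).ne)
    (fun q => EReal.sum_ne_top fun i _ => hne i _)
  exact (EReal.continuous_coe_mul_of_pos (hr i)).comp
    ((continuous_sidedKernel hK hsing j i).comp
      (f := fun q : (Fin n → ℝ) × ℝ × EReal => q.2.1 - q.1 i) (by fun_prop))

lemma mem_nodeInterval_iff {y : Fin n → ℝ} (hy : y ∈ closedSimplex n) {t : ℝ}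
    (ht : t ∈ Icc (0 : ℝ) 1) (j : Fin (n + 1)) :
    t ∈ nodeInterval y j ↔ ∀ i : Fin n, if (i : ℕ) < j then y i ≤ t else t ≤ y i := by
  obtain ⟨hmono, -⟩ := hy
  have hj := j.isLt
  simp only [nodeInterval, extNode, mem_Icc, Fin.val_castSucc, Fin.val_succ]
  constructor
  · rintro ⟨h0, h1⟩ i
    split_ifs with hij
    · rw [dif_neg (by omega), dif_pos (by omega)] at h0
      exact (hmono (Fin.le_def.2 (by simp; omega))).trans h0
    · rw [dif_neg (by omega), dif_pos (by omega)] at h1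
      exact h1.trans (hmono (Fin.le_def.2 (by simp; omega)))
  · intro h
    constructor
    · split_ifs with h0 h1
      · exact ht.1
      · have := h ⟨j - 1, by omega⟩
        rwa [if_pos (show (j : ℕ) - 1 < j by omega)] at this
      · omega
    · rw [dif_neg (by omega)]
      split_ifs with h1
      · have := h ⟨j, by omega⟩
        rw [if_neg (by simp)] at this
        simpa using this
      · exact ht.2

lemma exists_mem_nodeInterval {y : Fin n → ℝ} (hy : y ∈ closedSimplex n) {t : ℝ}
    (ht : t ∈ Icc (0 : ℝ) 1) : ∃ j, t ∈ nodeInterval y j := by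
  classical
  have hex : ∃ k : ℕ, ∀ i : Fin n, k ≤ i → t ≤ y i := ⟨n, fun i hi => absurd i.isLt (by omega)⟩
  have hle : Nat.find hex ≤ n := Nat.find_min' hex fun i hi => absurd i.isLt (by omega)
  refine ⟨⟨Nat.find hex, by omega⟩, (mem_nodeInterval_iff hy ht _).2 fun i => ?_⟩
  split_ifs with hi
  · have := Nat.find_min hex hi
    push Not at this
    obtain ⟨i', hii', hlt⟩ := this
    exact (hy.1 (Fin.le_def.2 hii')).trans hlt.le
  · exact Nat.find_spec hex i (not_lt.1 hi)

lemma sidedKernel_sub_of_mem {y : Fin n → ℝ} (hy : y ∈ closedSimplex n) {t : ℝ}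
    (ht : t ∈ Icc (0 : ℝ) 1) {j : Fin (n + 1)} (hj : t ∈ nodeInterval y j) (i : Fin n) :
    sidedKernel K j i (t - y i) = K (t - y i) := by
  have h := (mem_nodeInterval_iff hy ht j).1 hj i
  have hyi := hy.2 i
  unfold sidedKernel
  split_ifs at h ⊢
  · rw [rightKernel, if_pos (sub_nonneg.2 h), min_eq_left (by linarith [ht.2, hyi.1]),
      max_eq_right (sub_nonneg.2 h)]
  · rw [leftKernel, if_pos (sub_nonpos.2 h), min_eq_left (sub_nonpos.2 h),
      max_eq_right (by linarith [ht.1, hyi.2])]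

lemma sidedSum_of_mem {y : Fin n → ℝ} (hy : y ∈ closedSimplex n) {t : ℝ}
    (ht : t ∈ Icc (0 : ℝ) 1) (hJ : J t ≤ M) {j : Fin (n + 1)} (hj : t ∈ nodeInterval y j) :
    sidedSum r K M j y (t, J t) = sumTrans r K J y t := by
  simp only [sidedSum, sumTrans, min_eq_left hJ, sidedKernel_sub_of_mem hy ht hj]

lemma sidedSum_of_notMem (hr : ∀ i, 0 < r i) {y : Fin n → ℝ} (hy : y ∈ closedSimplex n) {t : ℝ}
    (ht : t ∈ Icc (0 : ℝ) 1) {j : Fin (n + 1)} (hj : t ∉ nodeInterval y j) (w : EReal) :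
    sidedSum r K M j y (t, w) = ⊥ := by
  rw [mem_nodeInterval_iff hy ht] at hj
  push Not at hj
  obtain ⟨i, hi⟩ := hj
  refine EReal.add_eq_bot_iff.2 (.inr (EReal.sum_eq_bot_iff.2 ⟨i, Finset.mem_univ i, ?_⟩))
  rw [EReal.coe_mul_eq_bot_iff_of_pos (hr i)]
  unfold sidedKernel
  split_ifs at hi ⊢
  · exact if_neg (by simpa using hi)
  · exact if_neg (by simpa using hi)

lemma nodeInterval_subset {y : Fin n → ℝ} (hy : y ∈ closedSimplex n) (j : Fin (n + 1)) :
    nodeInterval y j ⊆ Icc 0 1 := by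
  have hnode (k : Fin (n + 2)) : extNode y k ∈ Icc (0 : ℝ) 1 := by
    unfold extNode
    split_ifs
    exacts [by simp, hy.2 _, by simp]
  exact Icc_subset_Icc (hnode _).1 (hnode _).2

/-- The closure of the graph of `J` over `[0,1]`. -/
def graphClosure (J : ℝ → EReal) : Set (ℝ × EReal) :=
  closure ((fun t => (t, J t)) '' Icc 0 1)

lemma isCompact_graphClosure : IsCompact (graphClosure J) :=
  (isCompact_Icc.prod isCompact_univ).of_isClosed_subset isClosed_closure <|
    closure_minimal (by rintro _ ⟨t, ht, rfl⟩; exact ⟨ht, mem_univ _⟩)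
      (isClosed_Icc.prod isClosed_univ)

lemma graphClosure_nonempty : (graphClosure J).Nonempty :=
  ((nonempty_Icc.2 zero_le_one).image _).closure

lemma mj_eq_sSup_graphClosure (hr : ∀ i, 0 < r i) (hK : IsKernel K) (hsing : SingularKernel K)
    (hM : ∀ t ∈ Icc (0 : ℝ) 1, J t ≤ M) (j : Fin (n + 1)) {y : Fin n → ℝ}
    (hy : y ∈ closedSimplex n) :
    mj r K J j y = sSup (sidedSum r K M j y '' graphClosure J) := by
  apply le_antisymm
  · refine sSup_le ?_
    rintro _ ⟨t, hj, rfl⟩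
    have ht := nodeInterval_subset hy j hj
    rw [← sidedSum_of_mem hy ht (hM t ht) hj]
    exact le_sSup (mem_image_of_mem _ (subset_closure (mem_image_of_mem _ ht)))
  · refine sSup_le ?_
    rintro _ ⟨p, hp, rfl⟩
    have hcont : Continuous (sidedSum r K M j y) :=
      (continuous_sidedSum hr hK hsing j).comp (Continuous.prodMk_right y)
    refine closure_minimal (t := {p | sidedSum r K M j y p ≤ mj r K J j y}) ?_
      (isClosed_le hcont continuous_const) hp
    rintro _ ⟨t, ht, rfl⟩
    by_cases hj : t ∈ nodeInterval y j
    · exact (sidedSum_of_mem hy ht (hM t ht) hj).trans_le (le_sSup (mem_image_of_mem _ hj))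
    · exact (sidedSum_of_notMem hr hy ht hj _).trans_le bot_le

lemma continuousOn_mj (hr : ∀ i, 0 < r i) (hK : IsKernel K) (hsing : SingularKernel K)
    (hM : ∀ t ∈ Icc (0 : ℝ) 1, J t ≤ M) (j : Fin (n + 1)) :
    ContinuousOn (mj r K J j) (closedSimplex n) :=
  (isCompact_graphClosure.continuous_sSup (continuous_sidedSum hr hK hsing j)).continuousOn.congr
    fun _ hy => mj_eq_sSup_graphClosure hr hK hsing hM j hy

lemma mj_ne_top (hr : ∀ i, 0 < r i) (hK : IsKernel K) (hsing : SingularKernel K)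
    (hM : ∀ t ∈ Icc (0 : ℝ) 1, J t ≤ M) (j : Fin (n + 1)) {y : Fin n → ℝ}
    (hy : y ∈ closedSimplex n) : mj r K J j y ≠ ⊤ := by
  have hcont : Continuous (sidedSum r K M j y) :=
    (continuous_sidedSum hr hK hsing j).comp (Continuous.prodMk_right y)
  obtain ⟨p, -, hp⟩ := (isCompact_graphClosure.image hcont).sSup_mem
    (graphClosure_nonempty (J := J) |>.image _)
  rw [mj_eq_sSup_graphClosure hr hK hsing hM j hy, ← hp]
  exact sidedSum_ne_top hr hK j y p

/-- The weight of a point of `[0,1]`: endpoints count `1/2`, interior points count `1`. -/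
def pointWeight (t : ℝ) : ℝ := if t = 0 ∨ t = 1 then 1 / 2 else 1

lemma pointWeight_nonneg (t : ℝ) : 0 ≤ pointWeight t := by
  unfold pointWeight
  split_ifs <;> norm_num

lemma IsKernel.sum_pointWeight_le_one (hK : IsKernel K) {a : ℝ} (ha : a ∈ Icc (0 : ℝ) 1)
    {T : Finset ℝ} (hT : (T : Set ℝ) ⊆ Icc 0 1) (hbot : ∀ t ∈ T, K (t - a) = ⊥) :
    ∑ t ∈ T, pointWeight t ≤ 1 := by
  have hcases (t : ℝ) (ht : t ∈ T) : t = a ∨ t = 0 ∧ a = 1 ∨ t = 1 ∧ a = 0 := by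
    by_contra! hne
    have ht' := hT ht
    refine hK.finite_off_zero (t - a) ⟨?_, ?_⟩ (sub_ne_zero.2 hne.1) (hbot t ht)
    · by_contra! hle
      exact hne.2.1 (by linarith [ht'.1, ha.2]) (by linarith [ht'.1, ha.2])
    · by_contra! hle
      exact hne.2.2 (by linarith [ht'.2, ha.1]) (by linarith [ht'.2, ha.1])
  by_cases hend : a = 0 ∨ a = 1
  · calc ∑ t ∈ T, pointWeight t ≤ ∑ t ∈ ({0, 1} : Finset ℝ), pointWeight t := by
          refine Finset.sum_le_sum_of_subset_of_nonneg (fun t ht => ?_)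
            fun t _ _ => pointWeight_nonneg t
          have := hcases t ht
          simp only [Finset.mem_insert, Finset.mem_singleton]
          grind
      _ ≤ 1 := by
          rw [Finset.sum_pair zero_ne_one]
          norm_num [pointWeight]
  · calc ∑ t ∈ T, pointWeight t ≤ ∑ t ∈ ({a} : Finset ℝ), pointWeight t := by
          refine Finset.sum_le_sum_of_subset_of_nonneg (fun t ht => ?_)
            fun t _ _ => pointWeight_nonneg t
          have := hcases t ht
          simp only [Finset.mem_singleton]
          grind
      _ ≤ 1 := by simp [pointWeight, hend]

lemma exists_sumTrans_ne_bot (hr : ∀ i, 0 < r i) (hK : IsKernel K) (hJ : IsFieldFn n J)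
    {y : Fin n → ℝ} (hy : y ∈ closedSimplex n) :
    ∃ t ∈ Icc (0 : ℝ) 1, sumTrans r K J y t ≠ ⊥ := by
  classical
  obtain ⟨-, -, T, hT, hTJ, hcard⟩ := hJ
  by_contra! hbot
  refine hcard.not_ge ?_
  have hnode (t : ℝ) (ht : t ∈ T) : ∃ i, K (t - y i) = ⊥ := by
    rcases EReal.add_eq_bot_iff.1 (hbot t (hT ht)) with h | h
    · exact absurd h (hTJ t ht)
    · obtain ⟨i, -, hi⟩ := EReal.sum_eq_bot_iff.1 h
      exact ⟨i, (EReal.coe_mul_eq_bot_iff_of_pos (hr i)).1 hi⟩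
  calc ∑ t ∈ T, pointWeight t
      ≤ ∑ t ∈ T, ∑ i, if K (t - y i) = ⊥ then pointWeight t else 0 := by
        refine Finset.sum_le_sum fun t ht => ?_
        obtain ⟨i, hi⟩ := hnode t ht
        refine (if_pos hi).symm.trans_le (Finset.single_le_sum
          (f := fun i => if K (t - y i) = ⊥ then pointWeight t else 0) (fun i _ => ?_)
          (Finset.mem_univ i))
        split_ifs
        exacts [pointWeight_nonneg t, le_rfl]
    _ = ∑ i, ∑ t ∈ T with K (t - y i) = ⊥, pointWeight t := by
        simp only [Finset.sum_comm (s := T), Finset.sum_filter]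
    _ ≤ ∑ _i : Fin n, 1 := Finset.sum_le_sum fun i _ =>
        hK.sum_pointWeight_le_one (hy.2 i) (fun t ht => hT (Finset.mem_filter.1 ht).1)
          fun t ht => (Finset.mem_filter.1 ht).2
    _ = n := by simp

lemma mbar_ne_bot (hr : ∀ i, 0 < r i) (hK : IsKernel K) (hJ : IsFieldFn n J)
    {y : Fin n → ℝ} (hy : y ∈ closedSimplex n) : mbar r K J y ≠ ⊥ := by
  obtain ⟨t, ht, hne⟩ := exists_sumTrans_ne_bot hr hK hJ hy
  obtain ⟨j, hj⟩ := exists_mem_nodeInterval hy ht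
  refine ne_bot_of_le_ne_bot hne ?_
  exact (le_sSup (mem_image_of_mem _ hj)).trans (le_iSup (fun j => mj r K J j y) j)

lemma mbar_ne_top (hr : ∀ i, 0 < r i) (hK : IsKernel K) (hsing : SingularKernel K)
    (hM : ∀ t ∈ Icc (0 : ℝ) 1, J t ≤ M) {y : Fin n → ℝ} (hy : y ∈ closedSimplex n) :
    mbar r K J y ≠ ⊤ := by
  obtain ⟨j, hj⟩ := exists_eq_ciSup_of_finite (f := fun j => mj r K J j y)
  exact hj.symm.trans_ne (mj_ne_top hr hK hsing hM j hy)

end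

theorem statement0 (n : ℕ) (hn : 0 < n) (r : Fin n → ℝ) (hr : ∀ j, 0 < r j)
    (K J : ℝ → EReal) (hK : IsKernel K)
    (hsing : SingularKernel K) (hJ : IsFieldFn n J) :
    (∀ j : Fin (n + 1), ContinuousOn (mj r K J j) (closedSimplex n)) ∧
    ContinuousOn (mbar r K J) (closedSimplex n) ∧
    ContinuousOn (munder r K J) (closedSimplex n) ∧
    (∀ y ∈ closedSimplex n, mbar r K J y ≠ ⊥) ∧
    ContinuousOn (fun y => (mbar r K J y).toReal) (closedSimplex n) := by
  obtain ⟨M, hM⟩ := hJ.2.1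
  have hmj := continuousOn_mj hr hK hsing hM
  have hbar : ContinuousOn (mbar r K J) (closedSimplex n) := by
    refine (ContinuousOn.finset_sup_apply (s := Finset.univ) fun j _ => hmj j).congr fun y _ => ?_
    exact (Finset.sup_univ_eq_iSup fun j => mj r K J j y).symm
  have hunder : ContinuousOn (munder r K J) (closedSimplex n) := by
    refine (ContinuousOn.finset_inf_apply (s := Finset.univ) fun j _ => hmj j).congr fun y _ => ?_
    exact (Finset.inf_univ_eq_iInf fun j => mj r K J j y).symm
  refine ⟨hmj, hbar, hunder, fun y hy => mbar_ne_bot hr hK hJ hy, ?_⟩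
  refine EReal.continuousOn_toReal.comp hbar fun y hy => ?_
  simpa using ⟨mbar_ne_bot hr hK hJ hy, mbar_ne_top hr hK hsing hM hy⟩
end
end

section
/- Let n ∈ ℕ, r₁,…,rₙ > 0, let K be a singular kernel function that is strictly monotone (SM), and let J be an arbitrary n-field function. Then the difference function Φ, restricted to the regularity set Y, is a locally bi-Lipschitz homeomorphism from Y onto ℝⁿ. -/
open Set Filter

noncomputable section

/-- The difference function `Φ(y) = (m₁(y) − m₀(y), …, mₙ(y) − m_{n-1}(y))`. -/
def Phi {n : ℕ} (r : Fin n → ℝ) (K J : ℝ → EReal) (y : Fin n → ℝ) : Fin n → ℝ :=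
  fun j => (mj r K J j.succ y).toReal - (mj r K J j.castSucc y).toReal

open scoped Topology

section Concave

/-- For a concave function on the line, the sum of the values at two outer points is at most the
sum at two inner points with the same midpoint. -/
theorem ConcaveOn.add_le_add_of_add_eq {s : Set ℝ} {f : ℝ → ℝ} (hf : ConcaveOn ℝ s f)
    {a b c d : ℝ} (ha : a ∈ s) (hd : d ∈ s) (hab : a ≤ b) (hac : a ≤ c) (h : a + d = b + c) :
    f a + f d ≤ f b + f c := by
  rcases (show a ≤ d by linarith).eq_or_lt with had | had
  · obtain rfl : a = b := by linarith
    obtain rfl : d = c := by linarith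
    rfl
  · have hpos : 0 < d - a := by linarith
    set l := (b - a) / (d - a) with hl
    have hl0 : 0 ≤ l := div_nonneg (by linarith) hpos.le
    have hl1 : l ≤ 1 := (div_le_one hpos).2 (by linarith)
    have hmul : l * (d - a) = b - a := by rw [hl]; field_simp
    have h1 := hf.2 ha hd (sub_nonneg.2 hl1) hl0 (by ring)
    have h2 := hf.2 ha hd hl0 (sub_nonneg.2 hl1) (by ring)
    simp only [smul_eq_mul] at h1 h2
    rw [show (1 - l) * a + l * d = b by linarith] at h1
    rw [show l * a + (1 - l) * d = c by linarith] at h2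
    linarith

/-- Chords of a concave function have slopes decreasing from left to right. -/
theorem ConcaveOn.mul_sub_le_mul_sub {s : Set ℝ} {f : ℝ → ℝ} (hf : ConcaveOn ℝ s f)
    {a b c d : ℝ} (ha : a ∈ s) (hd : d ∈ s) (hab : a < b) (hbc : b ≤ c) (hcd : c ≤ d) :
    (f d - f c) * (b - a) ≤ (f b - f a) * (d - c) := by
  have hsub : Icc a d ⊆ s := hf.1.ordConnected.out ha hd
  rcases hcd.eq_or_lt with rfl | hcd
  · simp
  have hc : c ∈ s := hsub ⟨by linarith, hcd.le⟩
  have h1 : (f d - f c) / (d - c) ≤ (f b - f a) / (b - a) := by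
    rcases hbc.eq_or_lt with rfl | hbc
    · exact hf.slope_anti_adjacent ha hd hab hcd
    · exact (hf.slope_anti_adjacent (hsub ⟨hab.le, by linarith⟩) hd hbc hcd).trans
        (hf.slope_anti_adjacent ha hc hab hbc)
  rwa [div_le_div_iff₀ (by linarith) (by linarith)] at h1

theorem ConcaveOn.exists_abs_sub_le_of_strictMonoOn {f : ℝ → ℝ} (hf : ConcaveOn ℝ (Ioo 0 1) f)
    (hmono : StrictMonoOn f (Ioo 0 1)) {δ : ℝ} (hδ : 0 < δ) :
    ∃ L : ℝ, 0 ≤ L ∧ ∀ u v, δ ≤ u → δ ≤ v → u < 1 → v < 1 → |f u - f v| ≤ L * |u - v| := by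
  rcases le_or_gt 1 δ with h1 | h1
  · exact ⟨0, le_rfl, fun u v hu _ hu1 => by linarith⟩
  have hδ2 : δ / 2 ∈ Ioo (0 : ℝ) 1 := ⟨by linarith, by linarith⟩
  have hδ1 : δ ∈ Ioo (0 : ℝ) 1 := ⟨hδ, h1⟩
  set L := (f δ - f (δ / 2)) / (δ / 2) with hL
  have hL0 : 0 ≤ L := div_nonneg (sub_nonneg.2 (hmono hδ2 hδ1 (by linarith)).le) (by linarith)
  have key : ∀ u v, δ ≤ u → u ≤ v → v < 1 → |f u - f v| ≤ L * |u - v| := by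
    intro u v hu huv hv
    have hus : u ∈ Ioo (0 : ℝ) 1 := ⟨by linarith, by linarith⟩
    have hvs : v ∈ Ioo (0 : ℝ) 1 := ⟨by linarith, by linarith⟩
    have h := hf.mul_sub_le_mul_sub hδ2 hvs (by linarith : δ / 2 < δ) hu huv
    have hle : f u ≤ f v := hmono.monotoneOn hus hvs huv
    rw [abs_sub_comm, abs_sub_comm u, abs_of_nonneg (by linarith), abs_of_nonneg (by linarith),
      hL, div_mul_eq_mul_div, le_div_iff₀ (by linarith)]
    linarith
  refine ⟨L, hL0, fun u v hu hv hu1 hv1 => ?_⟩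
  rcases le_total u v with h | h
  · exact key u v hu h hv1
  · rw [abs_sub_comm, abs_sub_comm u]
    exact key v u hv h hu1

theorem ConcaveOn.exists_mul_le_sub_of_strictMonoOn {f : ℝ → ℝ} (hf : ConcaveOn ℝ (Ioo 0 1) f)
    (hmono : StrictMonoOn f (Ioo 0 1)) {a : ℝ} (ha : 0 < a) :
    ∃ c : ℝ, 0 < c ∧ ∀ u v, 0 < u → u ≤ v → v ≤ 1 - a → c * (v - u) ≤ f v - f u := by
  rcases le_or_gt 1 a with h1 | h1
  · exact ⟨1, one_pos, fun u v hu huv hv => by linarith⟩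
  have hp : 1 - a ∈ Ioo (0 : ℝ) 1 := ⟨by linarith, by linarith⟩
  have hq : 1 - a / 2 ∈ Ioo (0 : ℝ) 1 := ⟨by linarith, by linarith⟩
  have hlt := hmono hp hq (by linarith)
  refine ⟨(f (1 - a / 2) - f (1 - a)) / (a / 2), div_pos (by linarith) (by linarith), ?_⟩
  intro u v hu huv hv
  rcases huv.eq_or_lt with rfl | huv
  · simp
  have h := hf.mul_sub_le_mul_sub ⟨hu, by linarith⟩ hq huv hv (by linarith : 1 - a ≤ 1 - a / 2)
  rw [div_mul_eq_mul_div, div_le_iff₀ (by linarith)]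
  linarith

end Concave

/-- The points of `D` strictly between the consecutive nodes `y_{j-1}` and `y_j` (zero-based),
with no constraint on the left for `j = 0` and on the right for `j = n`. -/
def cell {n : ℕ} (D : Set ℝ) (y : Fin n → ℝ) (j : Fin (n + 1)) : Set ℝ :=
  {t ∈ D | ∀ k : Fin n, ((k : ℕ) < j → y k < t) ∧ ((j : ℕ) ≤ k → t < y k)}

/-- The node systems in the open simplex all of whose cells are nonempty. -/
def cellRegular (n : ℕ) (D : Set ℝ) : Set (Fin n → ℝ) :=
  {y ∈ openSimplex n | ∀ j, (cell D y j).Nonempty}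

/-- A real-valued sum of translates. -/
def realSum {n : ℕ} (r : Fin n → ℝ) (κ φ : ℝ → ℝ) (y : Fin n → ℝ) (t : ℝ) : ℝ :=
  φ t + ∑ k, r k * κ (t - y k)

/-- The differences of consecutive interval maxima. -/
def maxDiff {n : ℕ} (M : Fin (n + 1) → (Fin n → ℝ) → ℝ) (y : Fin n → ℝ) : Fin n → ℝ :=
  fun j => M j.succ y - M j.castSucc y

/-- A strictly monotone singular kernel `κ`, a field `φ` with finiteness set `D`, and the
associated interval maxima `M`, all expressed with real numbers. -/
structure TranslateSystem (n : ℕ) (r : Fin n → ℝ) (κ φ : ℝ → ℝ) (D : Set ℝ)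
    (M : Fin (n + 1) → (Fin n → ℝ) → ℝ) : Prop where
  pos : ∀ j, 0 < r j
  concave_neg : ConcaveOn ℝ (Ioo (-1) 0) κ
  concave_pos : ConcaveOn ℝ (Ioo 0 1) κ
  anti : StrictAntiOn κ (Ioo (-1) 0)
  mono : StrictMonoOn κ (Ioo 0 1)
  bdd : ∃ C, ∀ u ∈ Ioo (-1 : ℝ) 1, u ≠ 0 → κ u ≤ C
  sing : ∀ B, ∃ δ > 0, ∀ u, u ≠ 0 → |u| < δ → κ u < B
  subset : D ⊆ Icc 0 1
  field_bdd : ∃ A, ∀ t ∈ D, φ t ≤ A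
  many : ∃ T : Finset ℝ, (T : Set ℝ) ⊆ D ∧ n < T.card
  isLUB : ∀ y ∈ openSimplex n, ∀ j, (cell D y j).Nonempty →
    IsLUB (realSum r κ φ y '' cell D y j) (M j y)

namespace TranslateSystem

variable {n : ℕ} {r : Fin n → ℝ} {κ φ : ℝ → ℝ} {D : Set ℝ} {M : Fin (n + 1) → (Fin n → ℝ) → ℝ}

section Kernel

theorem concaveOn_reflect (h : TranslateSystem n r κ φ D M) :
    ConcaveOn ℝ (Ioo 0 1) (fun u => κ (-u)) := by
  have h1 := h.concave_neg.comp_linearMap (-LinearMap.id : ℝ →ₗ[ℝ] ℝ)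
  have h2 : (-LinearMap.id : ℝ →ₗ[ℝ] ℝ) ⁻¹' Ioo (-1 : ℝ) 0 = Ioo 0 1 := by
    ext u
    simp [and_comm]
  rw [h2] at h1
  exact h1

theorem strictMonoOn_reflect (h : TranslateSystem n r κ φ D M) :
    StrictMonoOn (fun u => κ (-u)) (Ioo 0 1) := fun u hu v hv huv =>
  h.anti ⟨by linarith [hv.2], by linarith [hv.1]⟩ ⟨by linarith [hu.2], by linarith [hu.1]⟩
    (by linarith)

theorem exists_abs_kernel_sub_le (h : TranslateSystem n r κ φ D M) {δ : ℝ} (hδ : 0 < δ) :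
    ∃ L : ℝ, 0 ≤ L ∧ ∀ u v, |u| < 1 → |v| < 1 → (δ ≤ u ∧ δ ≤ v ∨ u ≤ -δ ∧ v ≤ -δ) →
      |κ u - κ v| ≤ L * |u - v| := by
  obtain ⟨L₁, h₁, H₁⟩ := h.concave_pos.exists_abs_sub_le_of_strictMonoOn h.mono hδ
  obtain ⟨L₂, h₂, H₂⟩ :=
    h.concaveOn_reflect.exists_abs_sub_le_of_strictMonoOn h.strictMonoOn_reflect hδ
  refine ⟨max L₁ L₂, le_max_of_le_left h₁, fun u v hu hv huv => ?_⟩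
  rw [abs_lt] at hu hv
  rcases huv with ⟨hu', hv'⟩ | ⟨hu', hv'⟩
  · exact (H₁ u v hu' hv' hu.2 hv.2).trans (by gcongr; exact le_max_left _ _)
  · have := H₂ (-u) (-v) (by linarith) (by linarith) (by linarith) (by linarith)
    rw [neg_neg, neg_neg, show -u - -v = -(u - v) by ring, abs_neg] at this
    exact this.trans (by gcongr; exact le_max_right _ _)

/-- Moving a node to the right changes the translate by an amount increasing in the argument, as
long as the argument stays on one side of both node positions. -/
theorem kernel_shift_le (h : TranslateSystem n r κ φ D M) {y z s t : ℝ} (hy : 0 < y) (hyz : y ≤ z)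
    (hz : z < 1) (hs : 0 ≤ s) (hst : s ≤ t) (ht : t ≤ 1) (hside : t < y ∨ z < s) :
    κ (s - z) - κ (s - y) ≤ κ (t - z) - κ (t - y) := by
  rcases hside with hside | hside
  · linarith [h.concave_neg.add_le_add_of_add_eq (a := s - z) (b := t - z) (c := s - y)
      (d := t - y) ⟨by linarith, by linarith⟩ ⟨by linarith, by linarith⟩ (by linarith)
      (by linarith) (by ring)]
  · linarith [h.concave_pos.add_le_add_of_add_eq (a := s - z) (b := t - z) (c := s - y)
      (d := t - y) ⟨by linarith, by linarith⟩ ⟨by linarith, by linarith⟩ (by linarith)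
      (by linarith) (by ring)]

end Kernel

theorem le_of_mem_cell (h : TranslateSystem n r κ φ D M) {y : Fin n → ℝ} (hy : y ∈ openSimplex n)
    {j : Fin (n + 1)} {t : ℝ} (ht : t ∈ cell D y j) : realSum r κ φ y t ≤ M j y :=
  (h.isLUB y hy j ⟨t, ht⟩).1 ⟨t, ht, rfl⟩

theorem exists_mem_cell_lt (h : TranslateSystem n r κ φ D M) {y : Fin n → ℝ}
    (hy : y ∈ cellRegular n D) (j : Fin (n + 1)) {ε : ℝ} (hε : 0 < ε) :
    ∃ t ∈ cell D y j, M j y - ε < realSum r κ φ y t := by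
  obtain ⟨_, ⟨t, ht, rfl⟩, h1, -⟩ :=
    (h.isLUB y hy.1 j (hy.2 j)).exists_between (sub_lt_self _ hε)
  exact ⟨t, ht, h1⟩

section Comparison

variable {x y z : Fin n → ℝ}

theorem sup_mem_cellRegular (hx : x ∈ cellRegular n D) (hy : y ∈ cellRegular n D) :
    x ⊔ y ∈ cellRegular n D := by
  refine ⟨⟨fun i j hij => max_lt_max (hx.1.1 hij) (hy.1.1 hij), fun j => ?_⟩, fun j => ?_⟩
  · exact ⟨lt_max_of_lt_left (hx.1.2 j).1, max_lt (hx.1.2 j).2 (hy.1.2 j).2⟩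
  · -- the cell of the maximum contains the cell of whichever system has the larger left node
    have key : ∀ x y : Fin n → ℝ, x ∈ cellRegular n D → y ∈ cellRegular n D →
        (∀ i : Fin n, (i : ℕ) + 1 = j → x i ≤ y i) → (cell D (x ⊔ y) j).Nonempty := by
      intro x y hx hy hxy
      obtain ⟨t, ht⟩ := hy.2 j
      refine ⟨t, ht.1, fun k => ⟨fun hk => max_lt ?_ ((ht.2 k).1 hk),
        fun hk => lt_max_of_lt_right ((ht.2 k).2 hk)⟩⟩
      let i : Fin n := ⟨(j : ℕ) - 1, by omega⟩
      have hki : k ≤ i := by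
        rw [Fin.le_def]
        change (k : ℕ) ≤ (j : ℕ) - 1
        omega
      have hi : (i : ℕ) + 1 = j := by
        change (j : ℕ) - 1 + 1 = j
        omega
      exact ((hx.1.1.monotone hki).trans (hxy i hi)).trans_lt ((ht.2 i).1 (by omega))
    by_cases hxy : ∀ i : Fin n, (i : ℕ) + 1 = j → x i ≤ y i
    · exact key x y hx hy hxy
    · push Not at hxy
      obtain ⟨i, hi, hlt⟩ := hxy
      rw [sup_comm]
      refine key y x hy hx fun i' hi' => ?_
      obtain rfl : i' = i := Fin.ext (by omega)
      exact hlt.le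

/-- The `j`-th difference increases when the nodes other than the `j`-th one move right. -/
theorem maxDiff_le_maxDiff (h : TranslateSystem n r κ φ D M) (hy : y ∈ cellRegular n D)
    (hz : z ∈ cellRegular n D) (hyz : y ≤ z) {j : Fin n} (hj : z j = y j) :
    maxDiff M y j ≤ maxDiff M z j := by
  refine le_of_forall_pos_le_add fun ε hε => ?_
  obtain ⟨t, ht, ht'⟩ := h.exists_mem_cell_lt hy j.succ (half_pos hε)
  obtain ⟨s, hs, hs'⟩ := h.exists_mem_cell_lt hz j.castSucc (half_pos hε)
  have hyt : y j < t := (ht.2 j).1 (by simp)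
  have hsy : s < y j := hj ▸ (hs.2 j).2 (by simp)
  have htz : t ∈ cell D z j.succ := by
    refine ⟨ht.1, fun k => ⟨fun hk => ?_, fun hk => ((ht.2 k).2 hk).trans_le (hyz k)⟩⟩
    have : k ≤ j := by rw [Fin.le_def]; simp at hk; omega
    exact ((hz.1.1.monotone this).trans_eq hj).trans_lt hyt
  have hsy' : s ∈ cell D y j.castSucc := by
    refine ⟨hs.1, fun k => ⟨fun hk => (hyz k).trans_lt ((hs.2 k).1 hk), fun hk => ?_⟩⟩
    have : j ≤ k := by rw [Fin.le_def]; simpa using hk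
    exact hsy.trans_le (hy.1.1.monotone this)
  have h1 := h.le_of_mem_cell hz.1 htz
  have h2 := h.le_of_mem_cell hy.1 hsy'
  have hsum : ∑ k, r k * (κ (s - z k) - κ (s - y k)) ≤
      ∑ k, r k * (κ (t - z k) - κ (t - y k)) := by
    refine Finset.sum_le_sum fun k _ => mul_le_mul_of_nonneg_left ?_ (h.pos k).le
    rcases lt_trichotomy k j with hk | rfl | hk
    · exact h.kernel_shift_le (hy.1.2 k).1 (hyz k) (hz.1.2 k).2 (h.subset hs.1).1
        (hsy.trans hyt).le (h.subset ht.1).2 (Or.inr ((hs.2 k).1 (by simpa using hk)))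
    · simp [hj]
    · exact h.kernel_shift_le (hy.1.2 k).1 (hyz k) (hz.1.2 k).2 (h.subset hs.1).1
        (hsy.trans hyt).le (h.subset ht.1).2
        (Or.inl ((ht.2 k).2 (by rw [Fin.lt_def] at hk; simpa using hk)))
  simp only [mul_sub, Finset.sum_sub_distrib] at hsum
  simp only [maxDiff, realSum] at *
  linarith

theorem first_max_le (h : TranslateSystem n r κ φ D M) (hy : y ∈ cellRegular n D)
    (hz : z ∈ cellRegular n D) (hyz : y ≤ z) : M 0 y ≤ M 0 z := by
  refine le_of_forall_pos_le_add fun ε hε => ?_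
  obtain ⟨t, ht, ht'⟩ := h.exists_mem_cell_lt hy 0 hε
  have htz : t ∈ cell D z 0 :=
    ⟨ht.1, fun k => ⟨fun hk => by simp at hk, fun hk => ((ht.2 k).2 hk).trans_le (hyz k)⟩⟩
  have h1 := h.le_of_mem_cell hz.1 htz
  have hsum : ∑ k, r k * κ (t - y k) ≤ ∑ k, r k * κ (t - z k) := by
    refine Finset.sum_le_sum fun k _ => mul_le_mul_of_nonneg_left ?_ (h.pos k).le
    have hk := (ht.2 k).2 (Nat.zero_le _)
    have h0 := (h.subset ht.1).1
    have h2 := hyz k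
    have h3 := (hz.1.2 k).2
    exact h.anti.antitoneOn ⟨by linarith, by linarith⟩ ⟨by linarith, by linarith⟩ (by linarith)
  simp only [realSum] at *
  linarith

theorem last_max_add_le (h : TranslateSystem n r κ φ D M) (hy : y ∈ cellRegular n D)
    (hz : z ∈ cellRegular n D) (hyz : y ≤ z) :
    M (Fin.last n) z + ∑ k, r k * (κ (1 - y k) - κ (1 - z k)) ≤ M (Fin.last n) y := by
  refine le_of_forall_pos_le_add fun ε hε => ?_
  obtain ⟨t, ht, ht'⟩ := h.exists_mem_cell_lt hz (Fin.last n) hε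
  have hty : t ∈ cell D y (Fin.last n) := by
    refine ⟨ht.1, fun k => ⟨fun hk => (hyz k).trans_lt ((ht.2 k).1 hk), fun hk => ?_⟩⟩
    exact absurd k.2 (not_lt.2 (by simpa using hk))
  have h1 := h.le_of_mem_cell hy.1 hty
  have hsum : ∑ k, r k * (κ (1 - y k) - κ (1 - z k)) ≤
      ∑ k, r k * (κ (t - y k) - κ (t - z k)) := by
    refine Finset.sum_le_sum fun k _ => mul_le_mul_of_nonneg_left ?_ (h.pos k).le
    have := h.kernel_shift_le (hy.1.2 k).1 (hyz k) (hz.1.2 k).2 (h.subset ht.1).1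
      (h.subset ht.1).2 le_rfl (Or.inr ((ht.2 k).1 (by simp)))
    linarith
  simp only [mul_sub, Finset.sum_sub_distrib] at hsum ⊢
  simp only [realSum] at *
  linarith

theorem sum_maxDiff (M : Fin (n + 1) → (Fin n → ℝ) → ℝ) (y : Fin n → ℝ) :
    ∑ j, maxDiff M y j = M (Fin.last n) y - M 0 y := by
  have h1 := Fin.sum_univ_succ (fun j => M j y)
  have h2 := Fin.sum_univ_castSucc (fun j => M j y)
  simp only [maxDiff, Finset.sum_sub_distrib]
  linarith

theorem sum_maxDiff_add_le (h : TranslateSystem n r κ φ D M) (hy : y ∈ cellRegular n D)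
    (hz : z ∈ cellRegular n D) (hyz : y ≤ z) :
    ∑ j, maxDiff M z j + ∑ k, r k * (κ (1 - y k) - κ (1 - z k)) ≤ ∑ j, maxDiff M y j := by
  rw [sum_maxDiff, sum_maxDiff]
  linarith [h.first_max_le hy hz hyz, h.last_max_add_le hy hz hyz]

theorem sum_kernel_sub_le (h : TranslateSystem n r κ φ D M) (hx : x ∈ cellRegular n D)
    (hy : y ∈ cellRegular n D) :
    ∑ k, r k * (κ (1 - y k) - κ (1 - (x ⊔ y) k)) ≤ ∑ j, |maxDiff M x j - maxDiff M y j| := by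
  have hz := sup_mem_cellRegular hx hy
  have h1 := h.sum_maxDiff_add_le hy hz le_sup_right
  have h2 : ∑ j, (maxDiff M y j - maxDiff M (x ⊔ y) j) ≤
      ∑ j, |maxDiff M x j - maxDiff M y j| := by
    refine Finset.sum_le_sum fun j _ => ?_
    rcases le_total (x j) (y j) with hj | hj
    · have := h.maxDiff_le_maxDiff hy hz le_sup_right (j := j) (by simpa using hj)
      linarith [abs_nonneg (maxDiff M x j - maxDiff M y j)]
    · have := h.maxDiff_le_maxDiff hx hz le_sup_left (j := j) (by simpa using hj)
      linarith [neg_abs_le (maxDiff M x j - maxDiff M y j)]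
  rw [Finset.sum_sub_distrib] at h2
  linarith

/-- The difference map expands distances by a fixed factor among regular node systems that are
bounded away from the left endpoint. -/
theorem exists_mul_dist_le (h : TranslateSystem n r κ φ D M) {a : ℝ} (ha : 0 < a) :
    ∃ c > 0, ∀ x ∈ cellRegular n D, ∀ y ∈ cellRegular n D, (∀ k, a ≤ x k) → (∀ k, a ≤ y k) →
      c * dist x y ≤ dist (maxDiff M x) (maxDiff M y) := by
  rcases isEmpty_or_nonempty (Fin n) with hn | hn
  · exact ⟨1, one_pos, fun x _ y _ _ _ => by rw [Subsingleton.elim x y]; simp⟩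
  obtain ⟨c, hc, H⟩ := h.concave_pos.exists_mul_le_sub_of_strictMonoOn h.mono ha
  obtain ⟨i, hi⟩ := Finite.exists_min r
  have hn0 : (0 : ℝ) < n := by
    have : 0 < n := Fin.pos_iff_nonempty.2 hn
    exact_mod_cast this
  have key : ∀ x ∈ cellRegular n D, ∀ y ∈ cellRegular n D, (∀ k, a ≤ y k) → ∀ k,
      r i * (c * (x k - y k)) ≤ n * dist (maxDiff M x) (maxDiff M y) := by
    intro x hx y hy hya k
    have hterm : ∀ k, c * ((x ⊔ y) k - y k) ≤ κ (1 - y k) - κ (1 - (x ⊔ y) k) := fun k => by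
      have h1 : y k ≤ (x ⊔ y) k := le_sup_right (a := x k)
      have h2 : (x ⊔ y) k < 1 := max_lt (hx.1.2 k).2 (hy.1.2 k).2
      have := H (1 - (x ⊔ y) k) (1 - y k) (by linarith) (by linarith) (by linarith [hya k])
      linarith
    have hnonneg : ∀ k, 0 ≤ κ (1 - y k) - κ (1 - (x ⊔ y) k) := fun k =>
      (mul_nonneg hc.le (sub_nonneg.2 (le_sup_right (a := x k)))).trans (hterm k)
    calc r i * (c * (x k - y k)) ≤ r i * (κ (1 - y k) - κ (1 - (x ⊔ y) k)) := by
          refine mul_le_mul_of_nonneg_left (le_trans ?_ (hterm k)) (h.pos i).le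
          gcongr
          exact le_sup_left (b := y k)
      _ ≤ r k * (κ (1 - y k) - κ (1 - (x ⊔ y) k)) :=
          mul_le_mul_of_nonneg_right (hi k) (hnonneg k)
      _ ≤ ∑ k, r k * (κ (1 - y k) - κ (1 - (x ⊔ y) k)) :=
          Finset.single_le_sum (f := fun k => r k * (κ (1 - y k) - κ (1 - (x ⊔ y) k)))
            (fun k _ => mul_nonneg (h.pos k).le (hnonneg k)) (Finset.mem_univ k)
      _ ≤ ∑ j, |maxDiff M x j - maxDiff M y j| := h.sum_kernel_sub_le hx hy
      _ ≤ ∑ _j : Fin n, dist (maxDiff M x) (maxDiff M y) :=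
          Finset.sum_le_sum fun j _ => dist_le_pi_dist (maxDiff M x) (maxDiff M y) j
      _ = n * dist (maxDiff M x) (maxDiff M y) := by simp
  refine ⟨r i * c / n, div_pos (mul_pos (h.pos i) hc) hn0, fun x hx y hy hxa hya => ?_⟩
  rw [div_mul_eq_mul_div, div_le_iff₀ hn0, ← le_div_iff₀' (mul_pos (h.pos i) hc),
    dist_pi_le_iff (by have := (h.pos i).le; positivity)]
  intro k
  rw [le_div_iff₀' (mul_pos (h.pos i) hc), Real.dist_eq, mul_assoc]
  rcases abs_cases (x k - y k) with ⟨he, -⟩ | ⟨he, -⟩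
  · rw [he]
    linarith [key x hx y hy hya k]
  · rw [he, neg_sub]
    have := key y hy x hx hxa k
    rw [dist_comm] at this
    linarith

end Comparison

section Local

/-- A sum of translates bounded below forces the argument to stay away from the nodes. -/
theorem exists_le_abs_sub (h : TranslateSystem n r κ φ D M) (B : ℝ) :
    ∃ δ > 0, ∀ y ∈ openSimplex n, ∀ j, ∀ t ∈ cell D y j, -B < realSum r κ φ y t →
      ∀ k, δ ≤ |t - y k| := by
  obtain ⟨C, hC⟩ := h.bdd
  obtain ⟨A, hA⟩ := h.field_bdd
  set P := B + A + ∑ k, r k * |C| with hP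
  obtain ⟨δ, hδ, H⟩ := h.sing (-∑ k, |P| / r k)
  refine ⟨δ, hδ, fun y hy j t ht hlow i => not_lt.1 fun hlt => ?_⟩
  have hne : ∀ k, t - y k ≠ 0 := fun k => by
    rcases lt_or_ge (k : ℕ) j with hk | hk
    · exact (sub_pos.2 ((ht.2 k).1 hk)).ne'
    · exact (sub_neg.2 ((ht.2 k).2 hk)).ne
  have ht01 := h.subset ht.1
  have hup : ∀ k, r k * κ (t - y k) ≤ r k * |C| := fun k =>
    mul_le_mul_of_nonneg_left ((hC _ ⟨by linarith [(hy.2 k).2, ht01.1],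
      by linarith [(hy.2 k).1, ht01.2]⟩ (hne k)).trans (le_abs_self C)) (h.pos k).le
  have hsmall := H _ (hne i) hlt
  have hsum : ∑ k, r k * κ (t - y k) ≤ r i * κ (t - y i) + ∑ k, r k * |C| := by
    rw [← Finset.add_sum_erase _ _ (Finset.mem_univ i)]
    refine add_le_add le_rfl ((Finset.sum_le_sum fun k _ => hup k).trans ?_)
    exact Finset.sum_le_sum_of_subset_of_nonneg (Finset.erase_subset _ _)
      fun k _ _ => mul_nonneg (h.pos k).le (abs_nonneg C)
  have h1 : |P| / r i ≤ ∑ k, |P| / r k :=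
    Finset.single_le_sum (f := fun k => |P| / r k)
      (fun k _ => div_nonneg (abs_nonneg P) (h.pos k).le) (Finset.mem_univ i)
  have h2 : r i * κ (t - y i) < -|P| := by
    have h3 : κ (t - y i) < -(|P| / r i) := by linarith
    have h4 := mul_lt_mul_of_pos_left h3 (h.pos i)
    rwa [mul_neg, mul_div_cancel₀ _ (h.pos i).ne'] at h4
  simp only [realSum] at hlow
  linarith [hA t ht.1, le_abs_self P]

/-- On the node systems with interval maxima bounded below, the interval maxima decrease at most
linearly, uniformly, and small perturbations are regular. -/
theorem exists_sub_mul_dist_le (h : TranslateSystem n r κ φ D M) (B : ℝ) :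
    ∃ δ > 0, ∃ L > 0, ∀ x ∈ cellRegular n D, (∀ j, -B ≤ M j x) → ∀ y, dist x y ≤ δ →
      y ∈ cellRegular n D ∧ ∀ j, M j x - L * dist x y ≤ M j y := by
  obtain ⟨δ, hδ, H⟩ := h.exists_le_abs_sub (B + 1)
  obtain ⟨L, hL, HL⟩ := h.exists_abs_kernel_sub_le (half_pos hδ)
  have hR : 0 ≤ ∑ k, r k := Finset.sum_nonneg fun k _ => (h.pos k).le
  refine ⟨δ / 2, half_pos hδ, (∑ k, r k) * L + 1, by positivity, fun x hx hxB y hxy => ?_⟩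
  have hdist : ∀ k, |x k - y k| ≤ δ / 2 := fun k => (dist_le_pi_dist x y k).trans hxy
  have hleft : ∀ j, ∀ t ∈ cell D x j, -(B + 1) < realSum r κ φ x t → ∀ k : Fin n, (k : ℕ) < j →
      y k + δ / 2 ≤ t ∧ x k + δ ≤ t := by
    intro j t ht hlow k hk
    have h1 := H x hx.1 j t ht hlow k
    have h2 := (ht.2 k).1 hk
    rw [abs_of_pos (by linarith)] at h1
    have h3 := abs_le.1 (hdist k)
    exact ⟨by linarith, by linarith⟩
  have hright : ∀ j, ∀ t ∈ cell D x j, -(B + 1) < realSum r κ φ x t → ∀ k : Fin n, (j : ℕ) ≤ k →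
      t ≤ y k - δ / 2 ∧ t ≤ x k - δ := by
    intro j t ht hlow k hk
    have h1 := H x hx.1 j t ht hlow k
    have h2 := (ht.2 k).2 hk
    rw [abs_of_neg (by linarith)] at h1
    have h3 := abs_le.1 (hdist k)
    exact ⟨by linarith, by linarith⟩
  have hex : ∀ j, ∃ t ∈ cell D x j, -(B + 1) < realSum r κ φ x t := fun j => by
    obtain ⟨t, ht, hlt⟩ := h.exists_mem_cell_lt hx j one_pos
    exact ⟨t, ht, by linarith [hxB j]⟩
  have hcell : ∀ j, ∀ t ∈ cell D x j, -(B + 1) < realSum r κ φ x t → t ∈ cell D y j :=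
    fun j t ht hlow => ⟨ht.1, fun k => ⟨fun hk => by linarith [(hleft j t ht hlow k hk).1],
      fun hk => by linarith [(hright j t ht hlow k hk).1]⟩⟩
  have hyS : y ∈ openSimplex n := by
    refine ⟨fun i k hik => ?_, fun k => ⟨?_, ?_⟩⟩
    · obtain ⟨t, ht, hlow⟩ := hex k.castSucc
      have h1 := (hleft _ t ht hlow i (by simpa using hik)).1
      have h2 := (hright _ t ht hlow k (by simp)).1
      linarith
    · obtain ⟨t, ht, hlow⟩ := hex 0
      linarith [(hright _ t ht hlow k (Nat.zero_le _)).1, (h.subset ht.1).1]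
    · obtain ⟨t, ht, hlow⟩ := hex (Fin.last n)
      linarith [(hleft _ t ht hlow k (by simp)).1, (h.subset ht.1).2]
  refine ⟨⟨hyS, fun j => ?_⟩, fun j => ?_⟩
  · obtain ⟨t, ht, hlow⟩ := hex j
    exact ⟨t, hcell j t ht hlow⟩
  refine le_of_forall_pos_le_add fun ε hε => ?_
  obtain ⟨t, ht, hlt⟩ := h.exists_mem_cell_lt hx j (lt_min hε one_pos)
  have hlow : -(B + 1) < realSum r κ φ x t := by linarith [hxB j, min_le_right ε 1]
  have h1 := h.le_of_mem_cell hyS (hcell j t ht hlow)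
  have ht01 := h.subset ht.1
  have hsum : ∑ k, r k * (κ (t - x k) - κ (t - y k)) ≤ ∑ k, r k * (L * dist x y) := by
    refine Finset.sum_le_sum fun k _ => mul_le_mul_of_nonneg_left ?_ (h.pos k).le
    have hx1 := hx.1.2 k
    have hy1 := hyS.2 k
    refine (le_abs_self _).trans ((HL (t - x k) (t - y k) ?_ ?_ ?_).trans ?_)
    · exact abs_lt.2 ⟨by linarith [hx1.2, ht01.1], by linarith [hx1.1, ht01.2]⟩
    · exact abs_lt.2 ⟨by linarith [hy1.2, ht01.1], by linarith [hy1.1, ht01.2]⟩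
    · rcases lt_or_ge (k : ℕ) j with hk | hk
      · have := hleft j t ht hlow k hk
        exact Or.inl ⟨by linarith, by linarith⟩
      · have := hright j t ht hlow k hk
        exact Or.inr ⟨by linarith, by linarith⟩
    · rw [show t - x k - (t - y k) = -(x k - y k) by ring, abs_neg]
      exact mul_le_mul_of_nonneg_left (dist_le_pi_dist x y k) hL
  rw [← Finset.sum_mul] at hsum
  simp only [mul_sub, Finset.sum_sub_distrib] at hsum
  simp only [realSum] at *
  linarith [min_le_left ε 1, dist_nonneg (x := x) (y := y)]

theorem exists_forall_neg_le (y : Fin n → ℝ) : ∃ B, ∀ j, -B ≤ M j y := by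
  obtain ⟨i, hi⟩ := Finite.exists_min fun j => M j y
  exact ⟨-M i y, fun j => by simpa using hi j⟩

/-- The difference map is locally Lipschitz, and its domain is open. -/
theorem exists_dist_maxDiff_le (h : TranslateSystem n r κ φ D M) {y : Fin n → ℝ}
    (hy : y ∈ cellRegular n D) :
    ∃ ε > 0, ∃ L > 0, Metric.ball y ε ⊆ cellRegular n D ∧ ∀ x₁ ∈ Metric.ball y ε,
      ∀ x₂ ∈ Metric.ball y ε, dist (maxDiff M x₁) (maxDiff M x₂) ≤ L * dist x₁ x₂ := by
  obtain ⟨B, hB⟩ := exists_forall_neg_le (M := M) y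
  obtain ⟨δ, hδ, L, hL, H⟩ := h.exists_sub_mul_dist_le B
  obtain ⟨δ', hδ', L', hL', H'⟩ := h.exists_sub_mul_dist_le (B + L * δ)
  have hball : ∀ x ∈ Metric.ball y (min δ (δ' / 2)),
      x ∈ cellRegular n D ∧ ∀ j, -(B + L * δ) ≤ M j x := by
    intro x hx
    rw [Metric.mem_ball', lt_min_iff] at hx
    obtain ⟨h1, h2⟩ := H y hy hB x hx.1.le
    refine ⟨h1, fun j => ?_⟩
    have := mul_le_mul_of_nonneg_left hx.1.le hL.le
    linarith [h2 j, hB j]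
  refine ⟨min δ (δ' / 2), lt_min hδ (half_pos hδ'), 2 * L', by positivity,
    fun x hx => (hball x hx).1, fun x₁ h₁ x₂ h₂ => ?_⟩
  have hd : dist x₁ x₂ ≤ δ' := by
    have h3 : dist x₁ y < δ' / 2 := (lt_min_iff.1 h₁).2
    have h4 : dist x₂ y < δ' / 2 := (lt_min_iff.1 h₂).2
    linarith [dist_triangle_right x₁ x₂ y]
  have h12 := (H' x₁ (hball x₁ h₁).1 (hball x₁ h₁).2 x₂ hd).2
  have h21 := (H' x₂ (hball x₂ h₂).1 (hball x₂ h₂).2 x₁ (by rwa [dist_comm])).2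
  rw [dist_comm x₂ x₁] at h21
  rw [dist_pi_le_iff (by positivity)]
  intro j
  rw [Real.dist_eq, abs_le, maxDiff, maxDiff]
  constructor <;> linarith [h12 j.succ, h12 j.castSucc, h21 j.succ, h21 j.castSucc]

theorem continuousOn_maxDiff (h : TranslateSystem n r κ φ D M) :
    ContinuousOn (maxDiff M) (cellRegular n D) := by
  intro y hy
  obtain ⟨ε, hε, L, hL, -, H⟩ := h.exists_dist_maxDiff_le hy
  have hlip : LipschitzOnWith ⟨L, hL.le⟩ (maxDiff M) (Metric.ball y ε) :=
    LipschitzOnWith.of_dist_le_mul fun x₁ h₁ x₂ h₂ => H x₁ h₁ x₂ h₂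
  exact (hlip.continuousOn.continuousAt (Metric.ball_mem_nhds y hε)).continuousWithinAt

theorem isOpen_cellRegular (h : TranslateSystem n r κ φ D M) : IsOpen (cellRegular n D) :=
  Metric.isOpen_iff.2 fun _ hy => by
    obtain ⟨ε, hε, L, hL, hsub, -⟩ := h.exists_dist_maxDiff_le hy
    exact ⟨ε, hε, hsub⟩

end Local

section Proper

theorem exists_strictMono (h : TranslateSystem n r κ φ D M) :
    ∃ τ : Fin (n + 1) → ℝ, StrictMono τ ∧ ∀ i, τ i ∈ D := by
  obtain ⟨T, hT, hcard⟩ := h.many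
  obtain ⟨S, hS, hScard⟩ := Finset.exists_subset_card_eq (Nat.succ_le_of_lt hcard)
  exact ⟨S.orderEmbOfFin hScard, (S.orderEmbOfFin hScard).strictMono,
    fun i => hT (hS (S.orderEmbOfFin_mem hScard i))⟩

theorem nonempty_cellRegular (h : TranslateSystem n r κ φ D M) : (cellRegular n D).Nonempty := by
  obtain ⟨τ, hτ, hD⟩ := h.exists_strictMono
  have hlt : ∀ k : Fin n, τ k.castSucc < τ k.succ := fun k => hτ Fin.castSucc_lt_succ
  refine ⟨fun k => (τ k.castSucc + τ k.succ) / 2,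
    ⟨fun i k hik => ?_, fun k => ⟨?_, ?_⟩⟩,
    fun j => ⟨τ j, hD j, fun k => ⟨fun hk => ?_, fun hk => ?_⟩⟩⟩
  · have h1 : τ i.castSucc < τ k.castSucc := hτ (Fin.castSucc_lt_castSucc_iff.2 hik)
    have h2 : τ i.succ < τ k.succ := hτ (Fin.succ_lt_succ_iff.2 hik)
    change (τ i.castSucc + τ i.succ) / 2 < (τ k.castSucc + τ k.succ) / 2
    linarith
  · linarith [hlt k, (h.subset (hD k.castSucc)).1]
  · linarith [hlt k, (h.subset (hD k.succ)).2]
  · have : τ k.succ ≤ τ j := hτ.monotone (by rw [Fin.le_def]; simpa using hk)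
    linarith [hlt k]
  · have : τ j ≤ τ k.castSucc := hτ.monotone (by rw [Fin.le_def]; simpa using hk)
    linarith [hlt k]

theorem exists_mem_cell {y : Fin n → ℝ} (hy : y ∈ openSimplex n) {t : ℝ} (ht : t ∈ D)
    (hne : ∀ k, t ≠ y k) : ∃ j, t ∈ cell D y j := by
  classical
  by_cases hex : ∃ k, t < y k
  · refine ⟨(Fin.find _ hex).castSucc, ht, fun k => ⟨fun hk => ?_, fun hk => ?_⟩⟩
    · have := Fin.find_min hex (j := k) hk
      exact (not_lt.1 this).lt_of_ne (hne k).symm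
    · exact (Fin.find_spec hex).trans_le (hy.1.monotone (by rw [Fin.le_def]; simpa using hk))
  · push Not at hex
    exact ⟨Fin.last n, ht, fun k => ⟨fun _ => (hex k).lt_of_ne (hne k).symm,
      fun hk => absurd k.2 (not_lt.2 (by simpa using hk))⟩⟩

/-- The largest interval maximum is uniformly bounded below. -/
theorem exists_forall_exists_neg_le (h : TranslateSystem n r κ φ D M) :
    ∃ B, ∀ y ∈ openSimplex n, ∃ j, (cell D y j).Nonempty ∧ -B ≤ M j y := by
  obtain ⟨τ, hτ, hD⟩ := h.exists_strictMono
  obtain ⟨η, hη, hη1, hsep⟩ : ∃ η > 0, η < (1 : ℝ) ∧ ∀ i j, i ≠ j → 2 * η ≤ |τ i - τ j| := by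
    obtain ⟨p, hp⟩ := Finite.exists_min fun p : Fin (n + 1) × Fin (n + 1) =>
      if p.1 = p.2 then 1 else |τ p.1 - τ p.2|
    set q : ℝ := if p.1 = p.2 then 1 else |τ p.1 - τ p.2| with hq
    have hq0 : 0 < q := by
      rw [hq]
      split_ifs with hpp
      · exact one_pos
      · exact abs_pos.2 (sub_ne_zero.2 (hτ.injective.ne hpp))
    refine ⟨min (q / 2) (1 / 2), by positivity, by linarith [min_le_right (q / 2) (1 / 2)],
      fun i j hij => ?_⟩
    have := hp (i, j)
    simp only [hij, if_false] at this
    linarith [min_le_left (q / 2) (1 / 2)]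
  obtain ⟨i₀, hi₀⟩ := Finite.exists_min fun i => φ (τ i)
  refine ⟨-(φ (τ i₀) + ∑ k, r k * min (κ η) (κ (-η))), fun y hy => ?_⟩
  obtain ⟨i, hi⟩ : ∃ i, ∀ k, η ≤ |τ i - y k| := by
    by_contra! hcon
    choose f hf using hcon
    obtain ⟨i, j, hij, hfij⟩ := Fintype.exists_ne_map_eq_of_card_lt f (by simp)
    have h1 := hf i
    have h2 := hf j
    rw [← hfij, abs_sub_comm] at h2
    have h3 := abs_sub_le (τ i) (y (f i)) (τ j)
    linarith [hsep i j hij]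
  have hne : ∀ k, τ i ≠ y k := fun k hk => by
    have := hi k
    rw [hk, sub_self, abs_zero] at this
    linarith
  obtain ⟨j, hj⟩ := exists_mem_cell hy (hD i) hne
  refine ⟨j, ⟨_, hj⟩, ?_⟩
  have hτ01 := h.subset (hD i)
  have hsum : ∑ k, r k * min (κ η) (κ (-η)) ≤ ∑ k, r k * κ (τ i - y k) := by
    refine Finset.sum_le_sum fun k _ => mul_le_mul_of_nonneg_left ?_ (h.pos k).le
    have hk := hi k
    have hyk := hy.2 k
    rcases abs_cases (τ i - y k) with ⟨he, h0⟩ | ⟨he, h0⟩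
    · rw [he] at hk
      exact (min_le_left _ _).trans (h.mono.monotoneOn ⟨hη, hη1⟩
        ⟨by linarith, by linarith [hyk.1, hτ01.2]⟩ hk)
    · rw [he] at hk
      exact (min_le_right _ _).trans (h.anti.antitoneOn ⟨by linarith [hyk.2, hτ01.1], h0⟩
        ⟨by linarith, by linarith⟩ (by linarith))
  have := h.le_of_mem_cell hy hj
  have := hi₀ i
  simp only [realSum] at *
  linarith

/-- Bounded differences force the interval maxima to be uniformly bounded below. -/
theorem exists_forall_neg_le_of_abs_maxDiff_le (h : TranslateSystem n r κ φ D M) (R : ℝ) :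
    ∃ B, ∀ y ∈ cellRegular n D, (∀ j, |maxDiff M y j| ≤ R) → ∀ j, -B ≤ M j y := by
  obtain ⟨B, hB⟩ := h.exists_forall_exists_neg_le
  refine ⟨B + 2 * (n * |R|), fun y hy hR j => ?_⟩
  have key : ∀ i : Fin (n + 1), |M i y - M 0 y| ≤ (i : ℕ) * |R| := by
    intro i
    induction i using Fin.induction with
    | zero => simp
    | succ i ih =>
      have h1 := hR i
      have h2 := abs_add_le (M i.succ y - M i.castSucc y) (M i.castSucc y - M 0 y)
      rw [sub_add_sub_cancel] at h2
      have h3 := le_abs_self R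
      simp only [maxDiff, Fin.val_castSucc, Fin.val_succ] at *
      push_cast
      linarith
  have key' : ∀ i : Fin (n + 1), |M i y - M 0 y| ≤ n * |R| := fun i =>
    (key i).trans (mul_le_mul_of_nonneg_right (by exact_mod_cast Nat.lt_succ_iff.1 i.2)
      (abs_nonneg R))
  obtain ⟨i, -, hi⟩ := hB y hy.1
  have h1 := abs_le.1 (key' i)
  have h2 := abs_le.1 (key' j)
  linarith

end Proper

section Inverse

theorem injOn_maxDiff (h : TranslateSystem n r κ φ D M) :
    InjOn (maxDiff M) (cellRegular n D) := by
  intro x hx y hy hxy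
  rcases isEmpty_or_nonempty (Fin n) with hn | hn
  · exact Subsingleton.elim x y
  obtain ⟨i, hi⟩ := Finite.exists_min x
  obtain ⟨j, hj⟩ := Finite.exists_min y
  obtain ⟨c, hc, H⟩ := h.exists_mul_dist_le (lt_min (hx.1.2 i).1 (hy.1.2 j).1)
  have := H x hx y hy (fun k => (min_le_left _ _).trans (hi k))
    (fun k => (min_le_right _ _).trans (hj k))
  rw [hxy, dist_self] at this
  exact dist_le_zero.1 (nonpos_of_mul_nonpos_right this hc)

/-- Moving one node changes the other differences by less in total than its own difference. -/
theorem sum_abs_sub_lt (h : TranslateSystem n r κ φ D M) {x y : Fin n → ℝ}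
    (hx : x ∈ cellRegular n D) (hy : y ∈ cellRegular n D) (hxy : x ≤ y) {j : Fin n}
    (hj : x j < y j) (hk : ∀ k, k ≠ j → x k = y k) :
    ∑ k ∈ Finset.univ.erase j, |maxDiff M y k - maxDiff M x k| <
      maxDiff M x j - maxDiff M y j := by
  have h1 := h.sum_maxDiff_add_le hx hy hxy
  have h2 : ∑ k, r k * (κ (1 - x k) - κ (1 - y k)) = r j * (κ (1 - x j) - κ (1 - y j)) :=
    Finset.sum_eq_single j (fun k _ hkj => by rw [hk k hkj]; simp) (by simp)
  have h3 : κ (1 - y j) < κ (1 - x j) := h.mono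
    ⟨by linarith [(hy.1.2 j).2], by linarith [(hy.1.2 j).1]⟩
    ⟨by linarith [(hx.1.2 j).2], by linarith [(hx.1.2 j).1]⟩ (by linarith)
  have h4 := mul_pos (h.pos j) (sub_pos.2 h3)
  have h5 : ∑ k ∈ Finset.univ.erase j, |maxDiff M y k - maxDiff M x k| =
      ∑ k ∈ Finset.univ.erase j, (maxDiff M y k - maxDiff M x k) :=
    Finset.sum_congr rfl fun k hkj => abs_of_nonneg (sub_nonneg.2
      (h.maxDiff_le_maxDiff hx hy hxy (hk k (Finset.ne_of_mem_erase hkj)).symm))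
  rw [h5, Finset.sum_sub_distrib]
  rw [← Finset.add_sum_erase _ _ (Finset.mem_univ j),
    ← Finset.add_sum_erase _ (maxDiff M x) (Finset.mem_univ j)] at h1
  linarith

/-- A node system whose differences are not `v` is not a minimizer of the `ℓ¹` error. -/
theorem exists_sum_abs_lt (h : TranslateSystem n r κ φ D M) {v p : Fin n → ℝ}
    (hp : p ∈ cellRegular n D) (hpv : maxDiff M p ≠ v) :
    ∃ q ∈ cellRegular n D, ∑ j, |maxDiff M q j - v j| < ∑ j, |maxDiff M p j - v j| := by
  obtain ⟨j, hj⟩ := Function.ne_iff.1 hpv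
  have hcurve : Tendsto (fun s : ℝ => Function.update p j (p j + s)) (𝓝 0) (𝓝 p) := by
    have : Continuous fun s : ℝ => Function.update p j (p j + s) :=
      continuous_const.update j (by fun_prop)
    simpa using this.tendsto 0
  have hreg : ∀ᶠ q in 𝓝 p, q ∈ cellRegular n D := h.isOpen_cellRegular.mem_nhds hp
  have hcont : ContinuousAt (fun q => maxDiff M q j) p :=
    (continuous_apply j).continuousAt.comp (h.continuousOn_maxDiff.continuousAt hreg)
  -- it suffices to move the `j`-th node without overshooting the target
  have key : ∀ q, (∑ k ∈ Finset.univ.erase j, |maxDiff M q k - maxDiff M p k| <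
      |maxDiff M p j - v j| - |maxDiff M q j - v j|) →
      ∑ j, |maxDiff M q j - v j| < ∑ j, |maxDiff M p j - v j| := by
    intro q hlt
    rw [← Finset.add_sum_erase _ _ (Finset.mem_univ j),
      ← Finset.add_sum_erase _ (fun j => |maxDiff M p j - v j|) (Finset.mem_univ j)]
    have : ∑ k ∈ Finset.univ.erase j, |maxDiff M q k - v k| ≤
        ∑ k ∈ Finset.univ.erase j,
          (|maxDiff M q k - maxDiff M p k| + |maxDiff M p k - v k|) :=
      Finset.sum_le_sum fun k _ => abs_sub_le _ _ _
    rw [Finset.sum_add_distrib] at this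
    linarith
  rcases hj.lt_or_gt with hj | hj
  · have hev : ∀ᶠ s : ℝ in 𝓝[<] 0, Function.update p j (p j + s) ∈ cellRegular n D ∧
        maxDiff M (Function.update p j (p j + s)) j < v j :=
      (hcurve.eventually (hreg.and (hcont.eventually_lt_const hj))).filter_mono nhdsWithin_le_nhds
    obtain ⟨s, ⟨hq, hlt⟩, hs⟩ := (hev.and self_mem_nhdsWithin).exists
    refine ⟨_, hq, key _ ?_⟩
    have := h.sum_abs_sub_lt hq hp (update_le_self_iff.2 (by linarith)) (j := j)
      (by rw [Function.update_self]; linarith [hs])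
      (fun k hk => by simp [hk])
    rw [abs_of_neg (sub_neg.2 hj), abs_of_neg (sub_neg.2 hlt)]
    simp only [abs_sub_comm (maxDiff M p _)] at this
    linarith
  · have hev : ∀ᶠ s : ℝ in 𝓝[>] 0, Function.update p j (p j + s) ∈ cellRegular n D ∧
        v j < maxDiff M (Function.update p j (p j + s)) j :=
      (hcurve.eventually (hreg.and (hcont.eventually_const_lt hj))).filter_mono nhdsWithin_le_nhds
    obtain ⟨s, ⟨hq, hlt⟩, hs⟩ := (hev.and self_mem_nhdsWithin).exists
    refine ⟨_, hq, key _ ?_⟩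
    have := h.sum_abs_sub_lt hp hq (le_update_self_iff.2 (by linarith)) (j := j)
      (by rw [Function.update_self]; linarith [hs])
      (fun k hk => by simp [hk])
    rw [abs_of_pos (sub_pos.2 hj), abs_of_pos (sub_pos.2 hlt)]
    linarith

theorem exists_maxDiff_eq (h : TranslateSystem n r κ φ D M) (v : Fin n → ℝ) :
    ∃ y ∈ cellRegular n D, maxDiff M y = v := by
  obtain ⟨y₀, hy₀⟩ := h.nonempty_cellRegular
  set N : (Fin n → ℝ) → ℝ := fun y => ∑ j, |maxDiff M y j - v j| with hN
  have hNcont : ContinuousOn N (cellRegular n D) := by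
    have hc : Continuous fun w : Fin n → ℝ => ∑ j, |w j - v j| := by fun_prop
    exact hc.comp_continuousOn h.continuousOn_maxDiff
  set C := {y ∈ cellRegular n D | N y ≤ N y₀} with hC
  obtain ⟨B, hB⟩ := h.exists_forall_neg_le_of_abs_maxDiff_le (N y₀ + ∑ j, |v j|)
  have hCB : ∀ y ∈ C, ∀ j, -B ≤ M j y := fun y hy => hB y hy.1 fun j => by
    have h1 : |maxDiff M y j - v j| ≤ N y :=
      Finset.single_le_sum (f := fun j => |maxDiff M y j - v j|) (fun _ _ => abs_nonneg _)
        (Finset.mem_univ j)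
    have h2 : |v j| ≤ ∑ j, |v j| :=
      Finset.single_le_sum (f := fun j => |v j|) (fun _ _ => abs_nonneg _) (Finset.mem_univ j)
    have h3 := abs_add_le (maxDiff M y j - v j) (v j)
    rw [sub_add_cancel] at h3
    linarith [hy.2]
  obtain ⟨δ, hδ, L, hL, H⟩ := h.exists_sub_mul_dist_le B
  have hclosed : IsClosed C := by
    refine isClosed_of_closure_subset fun p hp => ?_
    obtain ⟨x, hx, hpx⟩ := Metric.mem_closure_iff.1 hp δ hδ
    have hpY := (H x hx.1 (hCB x hx) p (by rw [dist_comm]; exact hpx.le)).1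
    exact ⟨hpY, ContinuousWithinAt.closure_le hp
      ((hNcont p hpY).mono fun y hy => hy.1) continuousWithinAt_const fun y hy => hy.2⟩
  have hcompact : IsCompact C := by
    refine (isCompact_univ_pi fun _ : Fin n =>
      isCompact_Icc (a := (0 : ℝ)) (b := 1)).of_isClosed_subset hclosed
      fun y hy j _ => ⟨(hy.1.1.2 j).1.le, (hy.1.1.2 j).2.le⟩
  obtain ⟨p, hp, hmin⟩ := hcompact.exists_isMinOn ⟨y₀, hy₀, le_rfl⟩ (hNcont.mono fun y hy => hy.1)
  refine ⟨p, hp.1, by_contra fun hne => ?_⟩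
  obtain ⟨q, hq, hlt⟩ := h.exists_sum_abs_lt hp.1 hne
  exact absurd (hmin (⟨hq, hlt.le.trans hp.2⟩ : q ∈ C)) (not_le.2 hlt)

/-- The difference map has a continuous global inverse. -/
theorem exists_continuous_inverse (h : TranslateSystem n r κ φ D M) :
    ∃ Ψ : (Fin n → ℝ) → (Fin n → ℝ), Continuous Ψ ∧
      (∀ y ∈ cellRegular n D, Ψ (maxDiff M y) = y) ∧
      ∀ v, Ψ v ∈ cellRegular n D ∧ maxDiff M (Ψ v) = v := by
  choose Ψ hΨ hΨ' using h.exists_maxDiff_eq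
  refine ⟨Ψ, continuous_iff_continuousAt.2 fun v => ?_,
    fun y hy => h.injOn_maxDiff (hΨ _) hy (hΨ' _), fun v => ⟨hΨ v, hΨ' v⟩⟩
  obtain ⟨B, hB⟩ := h.exists_forall_neg_le_of_abs_maxDiff_le (‖v‖ + 1)
  obtain ⟨δ, hδ, L, hL, H⟩ := h.exists_sub_mul_dist_le B
  obtain ⟨c, hc, Hc⟩ := h.exists_mul_dist_le hδ
  have hlow : ∀ w ∈ Metric.ball v 1, ∀ k, δ ≤ Ψ w k := by
    intro w hw k
    have hwn : ∀ j, |maxDiff M (Ψ w) j| ≤ ‖v‖ + 1 := fun j => by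
      rw [hΨ']
      have h1 := norm_le_pi_norm w j
      have h2 := norm_le_norm_add_norm_sub v w
      rw [Metric.mem_ball', dist_eq_norm] at hw
      rw [Real.norm_eq_abs] at h1
      linarith
    have hd : dist (Ψ w) (fun i => Ψ w i - δ) ≤ δ := by
      rw [dist_pi_le_iff hδ.le]
      intro i
      rw [Real.dist_eq, sub_sub_cancel, abs_of_pos hδ]
    have := ((H (Ψ w) (hΨ w) (hB _ (hΨ w) hwn) _ hd).1.1.2 k).1
    linarith
  have hlip : LipschitzOnWith ⟨c⁻¹, (inv_pos.2 hc).le⟩ Ψ (Metric.ball v 1) :=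
    LipschitzOnWith.of_dist_le_mul fun w₁ h₁ w₂ h₂ => by
      have := Hc _ (hΨ w₁) _ (hΨ w₂) (hlow w₁ h₁) (hlow w₂ h₂)
      rw [hΨ', hΨ'] at this
      change dist (Ψ w₁) (Ψ w₂) ≤ c⁻¹ * dist w₁ w₂
      rw [inv_mul_eq_div, le_div_iff₀' hc]
      exact this
  exact hlip.continuousOn.continuousAt (Metric.ball_mem_nhds v one_pos)

/-- The difference map is locally bi-Lipschitz. -/
theorem exists_biLipschitz (h : TranslateSystem n r κ φ D M) {y : Fin n → ℝ}
    (hy : y ∈ cellRegular n D) :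
    ∃ ε > 0, ∃ L > 0, ∀ x₁ ∈ cellRegular n D ∩ Metric.ball y ε,
      ∀ x₂ ∈ cellRegular n D ∩ Metric.ball y ε,
        dist x₁ x₂ / L ≤ dist (maxDiff M x₁) (maxDiff M x₂) ∧
        dist (maxDiff M x₁) (maxDiff M x₂) ≤ L * dist x₁ x₂ := by
  obtain ⟨ε, hε, L, hL, -, H⟩ := h.exists_dist_maxDiff_le hy
  obtain ⟨a, ha, hya⟩ : ∃ a > 0, ∀ k, 2 * a ≤ y k := by
    rcases isEmpty_or_nonempty (Fin n) with hn | hn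
    · exact ⟨1, one_pos, fun k => hn.elim k⟩
    · obtain ⟨i, hi⟩ := Finite.exists_min y
      exact ⟨y i / 2, half_pos (hy.1.2 i).1, fun k => by linarith [hi k]⟩
  obtain ⟨c, hc, Hc⟩ := h.exists_mul_dist_le ha
  have hlow : ∀ x ∈ Metric.ball y (min ε a), ∀ k, a ≤ x k := fun x hx k => by
    have h1 : dist x y < a := (lt_min_iff.1 hx).2
    have h2 := abs_le.1 (dist_le_pi_dist x y k)
    linarith [hya k]
  refine ⟨min ε a, lt_min hε ha, max L c⁻¹, lt_max_of_lt_left hL, fun x₁ h₁ x₂ h₂ => ⟨?_, ?_⟩⟩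
  · have h3 := Hc x₁ h₁.1 x₂ h₂.1 (hlow x₁ h₁.2) (hlow x₂ h₂.2)
    rw [div_le_iff₀ (lt_max_of_lt_left hL)]
    calc dist x₁ x₂ = c * dist x₁ x₂ * c⁻¹ := by field_simp
      _ ≤ dist (maxDiff M x₁) (maxDiff M x₂) * max L c⁻¹ := by
        gcongr
        exact le_max_right _ _
  · have hsub := Metric.ball_subset_ball (x := y) (min_le_left ε a)
    exact (H x₁ (hsub h₁.2) x₂ (hsub h₂.2)).trans (by gcongr; exact le_max_left _ _)

end Inverse

end TranslateSystem

section Bridge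

theorem EReal.coe_finsetSum {ι : Type*} (s : Finset ι) (f : ι → ℝ) :
    ((∑ i ∈ s, f i : ℝ) : EReal) = ∑ i ∈ s, (f i : EReal) :=
  map_sum (⟨⟨(↑), EReal.coe_zero⟩, EReal.coe_add⟩ : ℝ →+ EReal) f s

theorem IsKernel.coe_toReal {K : ℝ → EReal} (hK : IsKernel K) {u : ℝ} (hu : u ∈ Ioo (-1 : ℝ) 1)
    (hu0 : u ≠ 0) : ((K u).toReal : EReal) = K u :=
  EReal.coe_toReal (hK.ne_top u) (hK.finite_off_zero u hu hu0)

variable {n : ℕ} {r : Fin n → ℝ} {K J : ℝ → EReal} {y : Fin n → ℝ}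

/-- The finiteness set of a field function. -/
def finiteSet (J : ℝ → EReal) : Set ℝ := {t ∈ Icc (0 : ℝ) 1 | J t ≠ ⊥}

theorem mem_cell_iff (hy : y ∈ openSimplex n) (j : Fin (n + 1)) (t : ℝ) :
    t ∈ cell (finiteSet J) y j ↔ t ∈ nodeInterval y j ∧ J t ≠ ⊥ ∧ ∀ k, t ≠ y k := by
  have hleft : extNode y j.castSucc ≤ t ↔
      ((j : ℕ) = 0 → 0 ≤ t) ∧ ∀ k : Fin n, (k : ℕ) + 1 = j → y k ≤ t := by
    have hjn : (j : ℕ) ≤ n := Nat.lt_succ_iff.1 j.2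
    by_cases hj : (j : ℕ) = 0
    · simp [extNode, hj]
    · simp only [extNode, Fin.val_castSucc, hj, hjn, dite_true, dite_false, false_imp_iff, true_and]
      refine ⟨fun h k hk => ?_, fun h => h _ ?_⟩
      · convert h using 2
        exact Fin.ext (by simp; omega)
      · simp only
        omega
  have hright : t ≤ extNode y j.succ ↔
      ((j : ℕ) = n → t ≤ 1) ∧ ∀ k : Fin n, (k : ℕ) = j → t ≤ y k := by
    have hjn : (j : ℕ) ≤ n := Nat.lt_succ_iff.1 j.2
    by_cases hj : (j : ℕ) = n
    · simp only [extNode, Fin.val_succ, hj]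
      simp only [Nat.add_eq_zero_iff, one_ne_zero, and_false, dite_false, Nat.not_succ_le_self,
        forall_const, iff_self_and]
      exact fun _ k hk => absurd k.2 (by omega)
    · have hj' : (j : ℕ) + 1 ≤ n := by omega
      simp only [extNode, Fin.val_succ, Nat.add_eq_zero_iff, one_ne_zero, and_false, dite_false, hj',
        dite_true, hj, false_imp_iff, true_and, Nat.add_sub_cancel]
      refine ⟨fun h k hk => ?_, fun h => h _ rfl⟩
      convert h using 2
      exact Fin.ext hk
  rw [nodeInterval, mem_Icc, hleft, hright]
  constructor
  · rintro ⟨⟨ht, hJ⟩, hcell⟩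
    refine ⟨⟨⟨fun _ => ht.1, fun k hk => ((hcell k).1 (by omega)).le⟩,
      fun _ => ht.2, fun k hk => ((hcell k).2 hk.ge).le⟩, hJ, fun k hk => ?_⟩
    rcases lt_or_ge (k : ℕ) j with hkj | hkj
    · exact ((hcell k).1 hkj).ne' hk
    · exact ((hcell k).2 hkj).ne hk
  · rintro ⟨⟨⟨h0, hl⟩, h1, hr⟩, hJ, hne⟩
    have hL : ∀ k : Fin n, (k : ℕ) < j → y k < t := fun k hk => by
      let i : Fin n := ⟨(j : ℕ) - 1, by omega⟩
      have hki : k ≤ i := by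
        rw [Fin.le_def]
        change (k : ℕ) ≤ (j : ℕ) - 1
        omega
      have hi : (i : ℕ) + 1 = j := by
        change (j : ℕ) - 1 + 1 = j
        omega
      exact (hy.1.monotone hki).trans_lt ((hl i hi).lt_of_ne (hne i).symm)
    have hR : ∀ k : Fin n, (j : ℕ) ≤ k → t < y k := fun k hk => by
      let i : Fin n := ⟨(j : ℕ), by omega⟩
      exact ((hr i rfl).lt_of_ne (hne i)).trans_le (hy.1.monotone (Fin.le_def.2 hk))
    refine ⟨⟨⟨?_, ?_⟩, hJ⟩, fun k => ⟨hL k, hR k⟩⟩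
    · by_cases hj : (j : ℕ) = 0
      · exact h0 hj
      · let i : Fin n := ⟨(j : ℕ) - 1, by omega⟩
        have hi : (i : ℕ) < j := by
          change (j : ℕ) - 1 < j
          omega
        exact (hy.2 i).1.le.trans (hL i hi).le
    · by_cases hj : (j : ℕ) = n
      · exact h1 hj
      · let i : Fin n := ⟨(j : ℕ), by omega⟩
        exact (hR i le_rfl).le.trans (hy.2 i).2.le

theorem sumTrans_eq_coe (hK : IsKernel K) (hJ : ∀ t, J t ≠ ⊤) (hy : y ∈ openSimplex n) {t : ℝ}
    (ht : t ∈ finiteSet J) (hne : ∀ k, t ≠ y k) :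
    sumTrans r K J y t =
      (realSum r (fun u => (K u).toReal) (fun s => (J s).toReal) y t : ℝ) := by
  rw [sumTrans, realSum, EReal.coe_add, EReal.coe_toReal (hJ t) ht.2, EReal.coe_finsetSum]
  refine congrArg _ (Finset.sum_congr rfl fun k _ => ?_)
  have hyk := hy.2 k
  rw [EReal.coe_mul, hK.coe_toReal ⟨by linarith [hyk.2, ht.1.1], by linarith [hyk.1, ht.1.2]⟩
    (sub_ne_zero.2 (hne k))]

theorem sumTrans_eq_bot (hr : ∀ j, 0 < r j) (hsing : SingularKernel K) {t : ℝ}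
    (h : J t = ⊥ ∨ ∃ k, t = y k) : sumTrans r K J y t = ⊥ := by
  rcases h with h | ⟨k, rfl⟩
  · rw [sumTrans, h, EReal.bot_add]
  · rw [sumTrans, ← Finset.add_sum_erase _ _ (Finset.mem_univ k), sub_self,
      show K 0 = ⊥ from hsing, EReal.coe_mul_bot_of_pos (hr k), EReal.bot_add, EReal.add_bot]

theorem mj_ne_bot_iff (hr : ∀ j, 0 < r j) (hK : IsKernel K) (hsing : SingularKernel K)
    (hJ : ∀ t, J t ≠ ⊤) (hy : y ∈ openSimplex n) (j : Fin (n + 1)) :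
    mj r K J j y ≠ ⊥ ↔ (cell (finiteSet J) y j).Nonempty := by
  constructor
  · intro h
    by_contra hempty
    refine h (sSup_eq_bot.2 ?_)
    rintro _ ⟨t, ht, rfl⟩
    refine sumTrans_eq_bot hr hsing (by_contra fun hcon => ?_)
    push Not at hcon
    exact hempty ⟨t, (mem_cell_iff hy j t).2 ⟨ht, hcon⟩⟩
  · rintro ⟨t, ht⟩ hbot
    have ht' := (mem_cell_iff hy j t).1 ht
    have h1 := sSup_eq_bot.1 hbot _ ⟨t, ht'.1, rfl⟩
    rw [sumTrans_eq_coe hK hJ hy ht.1 ht'.2.2] at h1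
    exact EReal.coe_ne_bot _ h1

theorem regSet_eq_cellRegular (hr : ∀ j, 0 < r j) (hK : IsKernel K) (hsing : SingularKernel K)
    (hJ : ∀ t, J t ≠ ⊤) : regSet r K J = cellRegular n (finiteSet J) :=
  Set.ext fun _ => and_congr_right fun hy => forall_congr' fun j =>
    mj_ne_bot_iff hr hK hsing hJ hy j

theorem StrictMonotoneKernel.exists_toReal_le (hK : IsKernel K) (hsm : StrictMonotoneKernel K) :
    ∃ C, ∀ u ∈ Ioo (-1 : ℝ) 1, u ≠ 0 → (K u).toReal ≤ C := by
  refine ⟨max (K (-1)).toReal (K 1).toReal, fun u hu hu0 => ?_⟩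
  have hcoe := hK.coe_toReal hu hu0
  have hbot := hK.finite_off_zero u hu hu0
  rcases lt_or_gt_of_ne hu0 with h | h
  · exact le_max_of_le_left (EReal.toReal_le_toReal
      (hsm.1 ⟨le_rfl, by norm_num⟩ ⟨hu.1.le, h⟩ hu.1).le hbot (hK.ne_top _))
  · exact le_max_of_le_right (EReal.toReal_le_toReal
      (hsm.2 ⟨h, hu.2.le⟩ ⟨by norm_num, le_rfl⟩ hu.2).le hbot (hK.ne_top _))

theorem SingularKernel.exists_toReal_lt (hK : IsKernel K) (hsing : SingularKernel K) (B : ℝ) :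
    ∃ δ > 0, ∀ u, u ≠ 0 → |u| < δ → (K u).toReal < B := by
  have hK0 : K 0 = ⊥ := hsing
  have hl := hK.lim_zero_left
  have hr := hK.lim_zero_right
  rw [hK0, EReal.tendsto_nhds_bot_iff_real] at hl hr
  have hev : ∀ᶠ u in 𝓝[≠] (0 : ℝ), K u < B := by
    rw [← Iio_union_Ioi, nhdsWithin_union]
    exact eventually_sup.2 ⟨hl B, hr B⟩
  rw [eventually_nhdsWithin_iff, Metric.eventually_nhds_iff] at hev
  obtain ⟨δ, hδ, H⟩ := hev
  refine ⟨min δ 1, lt_min hδ one_pos, fun u hu0 hu => ?_⟩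
  rw [lt_min_iff] at hu
  have h1 := H (y := u) (by simpa using hu.1) hu0
  rw [← hK.coe_toReal (abs_lt.1 hu.2) hu0] at h1
  exact_mod_cast h1

theorem IsFieldFn.exists_lt_card (hJ : IsFieldFn n J) :
    ∃ T : Finset ℝ, (T : Set ℝ) ⊆ finiteSet J ∧ n < T.card := by
  obtain ⟨-, -, T, hT, hTJ, hsum⟩ := hJ
  refine ⟨T, fun t ht => ⟨hT ht, hTJ t ht⟩, ?_⟩
  have : ∑ t ∈ T, (if t = 0 ∨ t = 1 then (1 / 2 : ℝ) else 1) ≤ ∑ _t ∈ T, (1 : ℝ) :=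
    Finset.sum_le_sum fun t _ => by split_ifs <;> norm_num
  rw [Finset.sum_const, nsmul_eq_mul, mul_one] at this
  exact_mod_cast hsum.trans_le this

theorem isLUB_toReal_of_isLUB_coe {s : Set ℝ} {a : EReal} (hs : s.Nonempty) (hbdd : BddAbove s)
    (h : IsLUB ((↑) '' s : Set EReal) a) : IsLUB s a.toReal := by
  obtain ⟨c, hc⟩ := hbdd
  obtain ⟨x, hx⟩ := hs
  have hac : a ≤ c := h.2 (by
    rintro _ ⟨y, hy, rfl⟩
    exact_mod_cast hc hy)
  have htop : a ≠ ⊤ := ne_top_of_le_ne_top (EReal.coe_ne_top c) hac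
  have hbot : a ≠ ⊥ := ne_bot_of_le_ne_bot (EReal.coe_ne_bot x) (h.1 ⟨x, hx, rfl⟩)
  have hcoe := EReal.coe_toReal htop hbot
  refine ⟨fun y hy => ?_, fun b hb => ?_⟩
  · have := h.1 ⟨y, hy, rfl⟩
    rw [← hcoe] at this
    exact_mod_cast this
  · have : a ≤ b := h.2 (by
      rintro _ ⟨y, hy, rfl⟩
      exact_mod_cast hb hy)
    rw [← hcoe] at this
    exact_mod_cast this

theorem IsFieldFn.exists_toReal_le (hJ : IsFieldFn n J) :
    ∃ A, ∀ t ∈ finiteSet J, (J t).toReal ≤ A := by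
  obtain ⟨A, hA⟩ := hJ.2.1
  refine ⟨A, fun t ht => ?_⟩
  have := hA t ht.1
  rw [← EReal.coe_toReal (hJ.1 t) ht.2] at this
  exact_mod_cast this

theorem isLUB_toReal_mj (hr : ∀ j, 0 < r j) (hK : IsKernel K) (hsing : SingularKernel K)
    (hsm : StrictMonotoneKernel K) (hJ : IsFieldFn n J) (hy : y ∈ openSimplex n) {j : Fin (n + 1)}
    (hj : (cell (finiteSet J) y j).Nonempty) :
    IsLUB (realSum r (fun u => (K u).toReal) (fun s => (J s).toReal) y '' cell (finiteSet J) y j)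
      (mj r K J j y).toReal := by
  obtain ⟨C, hC⟩ := hsm.exists_toReal_le hK
  obtain ⟨A, hA⟩ := hJ.exists_toReal_le
  have hne : ∀ t ∈ cell (finiteSet J) y j, ∀ k, t ≠ y k := fun t ht =>
    ((mem_cell_iff hy j t).1 ht).2.2
  refine isLUB_toReal_of_isLUB_coe (hj.image _) ⟨A + ∑ k, r k * C, ?_⟩ ⟨?_, fun b hb => ?_⟩
  · rintro _ ⟨t, ht, rfl⟩
    refine add_le_add (hA t ht.1) (Finset.sum_le_sum fun k _ =>
      mul_le_mul_of_nonneg_left (hC _ ?_ (sub_ne_zero.2 (hne t ht k))) (hr k).le)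
    have hyk := hy.2 k
    exact ⟨by linarith [hyk.2, ht.1.1.1], by linarith [hyk.1, ht.1.1.2]⟩
  · rintro _ ⟨_, ⟨t, ht, rfl⟩, rfl⟩
    rw [← sumTrans_eq_coe hK hJ.1 hy ht.1 (hne t ht)]
    exact le_sSup ⟨t, ((mem_cell_iff hy j t).1 ht).1, rfl⟩
  · refine sSup_le ?_
    rintro _ ⟨t, ht, rfl⟩
    by_cases hcon : J t = ⊥ ∨ ∃ k, t = y k
    · rw [sumTrans_eq_bot hr hsing hcon]
      exact bot_le
    · push Not at hcon
      have hcell := (mem_cell_iff hy j t).2 ⟨ht, hcon⟩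
      rw [sumTrans_eq_coe hK hJ.1 hy hcell.1 hcon.2]
      exact hb ⟨_, ⟨t, hcell, rfl⟩, rfl⟩

theorem translateSystem_of_isKernel (hr : ∀ j, 0 < r j) (hK : IsKernel K)
    (hsing : SingularKernel K) (hsm : StrictMonotoneKernel K) (hJ : IsFieldFn n J) :
    TranslateSystem n r (fun u => (K u).toReal) (fun s => (J s).toReal) (finiteSet J)
      (fun j y => (mj r K J j y).toReal) where
  pos := hr
  concave_neg := hK.concave_neg
  concave_pos := hK.concave_pos
  anti u hu v hv huv := by
    have := hsm.1 ⟨hu.1.le, hu.2⟩ ⟨hv.1.le, hv.2⟩ huv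
    rw [← hK.coe_toReal ⟨hu.1, by linarith [hu.2]⟩ hu.2.ne,
      ← hK.coe_toReal ⟨hv.1, by linarith [hv.2]⟩ hv.2.ne] at this
    exact EReal.coe_lt_coe_iff.1 this
  mono u hu v hv huv := by
    have := hsm.2 ⟨hu.1, hu.2.le⟩ ⟨hv.1, hv.2.le⟩ huv
    rw [← hK.coe_toReal ⟨by linarith [hu.1], hu.2⟩ hu.1.ne',
      ← hK.coe_toReal ⟨by linarith [hv.1], hv.2⟩ hv.1.ne'] at this
    exact EReal.coe_lt_coe_iff.1 this
  bdd := hsm.exists_toReal_le hK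
  sing := hsing.exists_toReal_lt hK
  subset _ ht := ht.1
  field_bdd := hJ.exists_toReal_le
  many := hJ.exists_lt_card
  isLUB _ hy _ hj := isLUB_toReal_mj hr hK hsing hsm hJ hy hj

end Bridge

theorem statement1 (n : ℕ) (hn : 0 < n) (r : Fin n → ℝ) (hr : ∀ j, 0 < r j)
    (K J : ℝ → EReal) (hK : IsKernel K)
    (hsing : SingularKernel K) (hsm : StrictMonotoneKernel K) (hJ : IsFieldFn n J) :
    Set.BijOn (Phi r K J) (regSet r K J) Set.univ ∧
    ContinuousOn (Phi r K J) (regSet r K J) ∧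
    (∃ Ψ : (Fin n → ℝ) → (Fin n → ℝ), Continuous Ψ ∧
      (∀ y ∈ regSet r K J, Ψ (Phi r K J y) = y) ∧
      (∀ v, Ψ v ∈ regSet r K J ∧ Phi r K J (Ψ v) = v)) ∧
    (∀ y ∈ regSet r K J, ∃ ε > (0:ℝ), ∃ L > (0:ℝ),
      ∀ x₁ ∈ regSet r K J ∩ Metric.ball y ε, ∀ x₂ ∈ regSet r K J ∩ Metric.ball y ε,
        dist x₁ x₂ / L ≤ dist (Phi r K J x₁) (Phi r K J x₂) ∧
        dist (Phi r K J x₁) (Phi r K J x₂) ≤ L * dist x₁ x₂) := by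
  have h := translateSystem_of_isKernel hr hK hsing hsm hJ
  rw [regSet_eq_cellRegular hr hK hsing hJ.1]
  exact ⟨⟨mapsTo_univ _ _, h.injOn_maxDiff, fun v _ => h.exists_maxDiff_eq v⟩,
    h.continuousOn_maxDiff, h.exists_continuous_inverse, fun _ hy => h.exists_biLipschitz hy⟩
end
end

section
/- Let K be a kernel function, let 0 < α < a < b < β < 1, p, q > 0, and set μ := p(a−α)/(q(β−b)). If K is monotone (M) and μ ≤ 1, then for every t ∈ [β,1] one has p·K(t−α) + q·K(t−β) ≤ p·K(t−a) + q·K(t−b) (inequality in ℝ ∪ {−∞}). If in addition K is strictly concave, the inequality is strict for every t ∈ [β,1]. -/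
open Set Filter

noncomputable section

/-- Three-chord inequality for a kernel function on `[0, 1)`, where the left end may be `0`. -/
theorem IsKernel.slope_anti_adjacent {K : ℝ → EReal} (hK : IsKernel K) {w x y : ℝ}
    (hw : 0 ≤ w) (hwx : w < x) (hxy : x < y) (hy : y < 1) (hbot : K w ≠ ⊥) :
    ((K y).toReal - (K x).toReal) / (y - x) ≤ ((K x).toReal - (K w).toReal) / (x - w) := by
  rcases hw.eq_or_lt with rfl | hw
  · have hlim : Tendsto (fun s => (K s).toReal) (nhdsWithin 0 (Ioi 0)) (nhds (K 0).toReal) :=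
      (EReal.tendsto_toReal (hK.ne_top 0) hbot).comp hK.lim_zero_right
    have hid : Tendsto (fun s : ℝ => s) (nhdsWithin 0 (Ioi 0)) (nhds 0) :=
      tendsto_id.mono_left nhdsWithin_le_nhds
    have hslope := (hlim.const_sub (K x).toReal).div (hid.const_sub x) (by linarith)
    refine ge_of_tendsto hslope ?_
    filter_upwards [Ioo_mem_nhdsGT hwx] with s hs
    exact hK.concave_pos.slope_anti_adjacent ⟨hs.1, by linarith [hs.2]⟩
      ⟨by linarith, hy⟩ hs.2 hxy
  · exact hK.concave_pos.slope_anti_adjacent ⟨hw, by linarith⟩ ⟨by linarith, hy⟩ hwx hxy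

/-- Weighted sums of finite values of a kernel function are computed in `ℝ`. -/
theorem IsKernel.weighted_add_eq_coe {K : ℝ → EReal} (hK : IsKernel K) {s t : ℝ}
    (hs : K s ≠ ⊥) (ht : K t ≠ ⊥) (p q : ℝ) :
    (p : EReal) * K s + (q : EReal) * K t =
      ((p * (K s).toReal + q * (K t).toReal : ℝ) : EReal) := by
  rw [EReal.coe_add, EReal.coe_mul, EReal.coe_mul, EReal.coe_toReal (hK.ne_top s) hs,
    EReal.coe_toReal (hK.ne_top t) ht]

theorem statement3 (K : ℝ → EReal) (hK : IsKernel K) (hM : MonotoneKernel K)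
    (α a b β : ℝ) (h0 : 0 < α) (h1 : α < a) (h2 : a < b) (h3 : b < β) (h4 : β < 1)
    (p q : ℝ) (hp : 0 < p) (hq : 0 < q)
    (hμ : p * (a - α) / (q * (β - b)) ≤ 1) :
    (∀ t ∈ Icc β (1:ℝ),
      (p : EReal) * K (t - α) + (q : EReal) * K (t - β) ≤
        (p : EReal) * K (t - a) + (q : EReal) * K (t - b)) ∧
    (StrictConcaveKernel K → ∀ t ∈ Icc β (1:ℝ),
      (p : EReal) * K (t - α) + (q : EReal) * K (t - β) <
        (p : EReal) * K (t - a) + (q : EReal) * K (t - b)) := by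
  have hμ' : p * (a - α) ≤ q * (β - b) := (div_le_one (mul_pos hq (by linarith))).1 hμ
  have hfin : ∀ s, 0 < s → s < 1 → K s ≠ ⊥ := fun s hs hs' =>
    hK.finite_off_zero s ⟨by linarith, hs'⟩ hs.ne'
  have hlt_of_bot : ∀ t ∈ Icc β (1:ℝ), K (t - β) = ⊥ →
      (p : EReal) * K (t - α) + (q : EReal) * K (t - β) <
        (p : EReal) * K (t - a) + (q : EReal) * K (t - b) := by
    rintro t ⟨ht, ht'⟩ hbot
    rw [hK.weighted_add_eq_coe (hfin (t - a) (by linarith) (by linarith))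
      (hfin (t - b) (by linarith) (by linarith)), hbot, EReal.coe_mul_bot_of_pos hq, EReal.add_bot]
    exact EReal.bot_lt_coe _
  have hslope_nonneg : ∀ t ∈ Icc β (1:ℝ),
      0 ≤ ((K (t - α)).toReal - (K (t - a)).toReal) / ((t - α) - (t - a)) := by
    rintro t ⟨ht, ht'⟩
    refine div_nonneg (sub_nonneg.2 ?_) (by linarith)
    exact EReal.toReal_le_toReal
      (hM.2 ⟨by linarith, by linarith⟩ ⟨by linarith, by linarith⟩ (by linarith))
      (hfin _ (by linarith) (by linarith)) (hK.ne_top _)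
  refine ⟨fun t ht => ?_, fun hS t ht => ?_⟩
  all_goals
    by_cases hbot : K (t - β) = ⊥
    · first
        | exact hlt_of_bot t ht hbot
        | exact (hlt_of_bot t ht hbot).le
    have hnonneg := hslope_nonneg t ht
    obtain ⟨ht, ht'⟩ := ht
    have hleft := hK.slope_anti_adjacent (w := t - β) (x := t - b) (y := t - a)
      (by linarith) (by linarith) (by linarith) (by linarith) hbot
    rw [hK.weighted_add_eq_coe (hfin (t - α) (by linarith) (by linarith)) hbot,
      hK.weighted_add_eq_coe (hfin (t - a) (by linarith) (by linarith))
        (hfin (t - b) (by linarith) (by linarith))]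
    have hαa : (K (t - α)).toReal - (K (t - a)).toReal =
        ((K (t - α)).toReal - (K (t - a)).toReal) / ((t - α) - (t - a)) * (a - α) := by
      rw [show (t - α) - (t - a) = a - α by ring, div_mul_cancel₀ _ (by linarith)]
    have hbβ : (K (t - b)).toReal - (K (t - β)).toReal =
        ((K (t - b)).toReal - (K (t - β)).toReal) / ((t - b) - (t - β)) * (β - b) := by
      rw [show (t - b) - (t - β) = β - b by ring, div_mul_cancel₀ _ (by linarith)]
    set u := ((K (t - α)).toReal - (K (t - a)).toReal) / ((t - α) - (t - a))
    set v := ((K (t - b)).toReal - (K (t - β)).toReal) / ((t - b) - (t - β))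
  · have huv : u ≤ v := (hK.concave_pos.slope_anti_adjacent (x := t - b) (y := t - a)
      (z := t - α) ⟨by linarith, by linarith⟩ ⟨by linarith, by linarith⟩
      (by linarith) (by linarith)).trans hleft
    rw [EReal.coe_le_coe_iff]
    have h₁ : p * (a - α) * u ≤ q * (β - b) * v :=
      mul_le_mul hμ' huv hnonneg (mul_pos hq (by linarith)).le
    linear_combination h₁ + p * hαa - q * hbβ
  · have huv : u < v := (hS.2.slope_anti_adjacent (x := t - b) (y := t - a)
      (z := t - α) ⟨by linarith, by linarith⟩ ⟨by linarith, by linarith⟩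
      (by linarith) (by linarith)).trans_le hleft
    rw [EReal.coe_lt_coe_iff]
    have h₁ : p * (a - α) * u < q * (β - b) * v :=
      mul_lt_mul' hμ' huv hnonneg (mul_pos hq (by linarith))
    linear_combination h₁ + p * hαa - q * hbβ
end
end

section
/- Let K be a kernel function (no monotonicity assumed), let 0 < α < a < b < β < 1, p, q > 0, and assume μ := p(a−α)/(q(β−b)) = 1. Then for every t ∈ [0,α] ∪ [β,1] one has p·K(t−α) + q·K(t−β) ≤ p·K(t−a) + q·K(t−b) (inequality in ℝ ∪ {−∞}). If K is strictly concave, the inequality is strict for every such t. -/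
open Set Filter

noncomputable section

/-- The slope inequality for a concave function extends to the right endpoint of its interval. -/
theorem ConcaveOn.slope_anti_adjacent_right_endpoint {f : ℝ → ℝ} {l r y z : ℝ}
    (hf : ConcaveOn ℝ (Ioo l r) f) (hlim : Tendsto f (nhdsWithin r (Iio r)) (nhds (f r)))
    (hly : l < y) (hyz : y < z) (hzr : z < r) :
    (f r - f z) / (r - z) ≤ (f z - f y) / (z - y) := by
  have hT : Tendsto (fun w => (f w - f z) / (w - z)) (nhdsWithin r (Iio r))
      (nhds ((f r - f z) / (r - z))) :=
    (hlim.sub_const _).div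
      ((tendsto_id.mono_left nhdsWithin_le_nhds).sub_const _) (sub_pos.2 hzr).ne'
  refine le_of_tendsto hT ?_
  filter_upwards [Ioo_mem_nhdsLT hzr] with w hw
  exact hf.slope_anti_adjacent ⟨hly, hyz.trans hzr⟩
    ⟨hly.trans (hyz.trans hw.1), hw.2⟩ hyz hw.1

/-- The slope inequality for a concave function extends to the left endpoint of its interval. -/
theorem ConcaveOn.slope_anti_adjacent_left_endpoint {f : ℝ → ℝ} {l r y z : ℝ}
    (hf : ConcaveOn ℝ (Ioo l r) f) (hlim : Tendsto f (nhdsWithin l (Ioi l)) (nhds (f l)))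
    (hly : l < y) (hyz : y < z) (hzr : z < r) :
    (f z - f y) / (z - y) ≤ (f y - f l) / (y - l) := by
  have hT : Tendsto (fun w => (f y - f w) / (y - w)) (nhdsWithin l (Ioi l))
      (nhds ((f y - f l) / (y - l))) :=
    (hlim.const_sub _).div
      ((tendsto_id.mono_left nhdsWithin_le_nhds).const_sub _) (sub_pos.2 hly).ne'
  refine ge_of_tendsto hT ?_
  filter_upwards [Ioo_mem_nhdsGT hly] with w hw
  exact hf.slope_anti_adjacent ⟨hw.1, hw.2.trans (hyz.trans hzr)⟩
    ⟨hly.trans hyz, hzr⟩ hw.2 hyz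

/-- For weights `p, q` preserving the weighted mean, the comparison of two weighted sums of values
of `f` reduces to the comparison of the two outer slopes. -/
theorem weighted_sum_sub_eq_slope_sub {f : ℝ → ℝ} {p q x₁ x₂ x₃ x₄ : ℝ}
    (h12 : x₁ < x₂) (h34 : x₃ < x₄) (hpq : p * (x₄ - x₃) = q * (x₂ - x₁)) :
    (p * f x₃ + q * f x₂) - (p * f x₄ + q * f x₁) =
      p * (x₄ - x₃) * ((f x₂ - f x₁) / (x₂ - x₁) - (f x₄ - f x₃) / (x₄ - x₃)) := by
  have e12 := div_mul_cancel₀ (f x₂ - f x₁) (sub_pos.2 h12).ne'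
  have e34 := div_mul_cancel₀ (f x₄ - f x₃) (sub_pos.2 h34).ne'
  linear_combination (-((f x₂ - f x₁) / (x₂ - x₁))) * hpq - q * e12 + p * e34

/-- An `EReal`-valued function satisfies the weighted comparison as soon as its outer slopes are
ordered whenever the outer values are finite; the comparison is strict if the slopes are. -/
theorem weighted_sum_le_and_lt_of_slopes {K : ℝ → EReal} (hK : ∀ t, K t ≠ ⊤)
    {p q x₁ x₂ x₃ x₄ : ℝ} (hp : 0 < p) (hq : 0 < q) (h12 : x₁ < x₂) (h34 : x₃ < x₄)
    (hpq : p * (x₄ - x₃) = q * (x₂ - x₁)) (hb2 : K x₂ ≠ ⊥) (hb3 : K x₃ ≠ ⊥) {P : Prop}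
    (hle : K x₁ ≠ ⊥ → K x₄ ≠ ⊥ → ((K x₄).toReal - (K x₃).toReal) / (x₄ - x₃) ≤
      ((K x₂).toReal - (K x₁).toReal) / (x₂ - x₁))
    (hlt : P → K x₁ ≠ ⊥ → K x₄ ≠ ⊥ → ((K x₄).toReal - (K x₃).toReal) / (x₄ - x₃) <
      ((K x₂).toReal - (K x₁).toReal) / (x₂ - x₁)) :
    (p : EReal) * K x₄ + (q : EReal) * K x₁ ≤ (p : EReal) * K x₃ + (q : EReal) * K x₂ ∧
    (P → (p : EReal) * K x₄ + (q : EReal) * K x₁ <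
      (p : EReal) * K x₃ + (q : EReal) * K x₂) := by
  have eR : (p : EReal) * K x₃ + (q : EReal) * K x₂ =
      ((p * (K x₃).toReal + q * (K x₂).toReal : ℝ) : EReal) := by
    push_cast
    rw [EReal.coe_toReal (hK _) hb2, EReal.coe_toReal (hK _) hb3]
  by_cases hb : K x₁ = ⊥ ∨ K x₄ = ⊥
  · have eL : (p : EReal) * K x₄ + (q : EReal) * K x₁ = ⊥ := by
      rcases hb with hb | hb
      · rw [hb, EReal.coe_mul_bot_of_pos hq, EReal.add_bot]
      · rw [hb, EReal.coe_mul_bot_of_pos hp, EReal.bot_add]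
    rw [eL, eR]
    exact ⟨bot_le, fun _ => EReal.bot_lt_coe _⟩
  · push Not at hb
    obtain ⟨hb1, hb4⟩ := hb
    have eL : (p : EReal) * K x₄ + (q : EReal) * K x₁ =
        ((p * (K x₄).toReal + q * (K x₁).toReal : ℝ) : EReal) := by
      push_cast
      rw [EReal.coe_toReal (hK _) hb1, EReal.coe_toReal (hK _) hb4]
    have key := weighted_sum_sub_eq_slope_sub (f := fun t => (K t).toReal) h12 h34 hpq
    have hc : 0 < p * (x₄ - x₃) := mul_pos hp (sub_pos.2 h34)
    rw [eL, eR, EReal.coe_le_coe_iff, EReal.coe_lt_coe_iff]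
    refine ⟨sub_nonneg.1 ?_, fun hP => sub_pos.1 ?_⟩
    · rw [key]
      exact mul_nonneg hc.le (sub_nonneg.2 (hle hb1 hb4))
    · rw [key]
      exact mul_pos hc (sub_pos.2 (hlt hP hb1 hb4))

/-- The weighted comparison for a kernel at points of `(-1, 0]`. -/
theorem IsKernel.weighted_sum_le_and_lt_neg {K : ℝ → EReal} (hK : IsKernel K)
    {p q x₁ x₂ x₃ x₄ : ℝ} (hp : 0 < p) (hq : 0 < q) (h1 : -1 < x₁) (h12 : x₁ < x₂)
    (h23 : x₂ < x₃) (h34 : x₃ < x₄) (h4 : x₄ ≤ 0) (hpq : p * (x₄ - x₃) = q * (x₂ - x₁)) :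
    (p : EReal) * K x₄ + (q : EReal) * K x₁ ≤ (p : EReal) * K x₃ + (q : EReal) * K x₂ ∧
    (StrictConcaveKernel K → (p : EReal) * K x₄ + (q : EReal) * K x₁ <
      (p : EReal) * K x₃ + (q : EReal) * K x₂) := by
  have m1 : x₁ ∈ Ioo (-1 : ℝ) 0 := ⟨h1, by linarith⟩
  have m2 : x₂ ∈ Ioo (-1 : ℝ) 0 := ⟨by linarith, by linarith⟩
  have m3 : x₃ ∈ Ioo (-1 : ℝ) 0 := ⟨by linarith, by linarith⟩
  have outer : K x₄ ≠ ⊥ → ((K x₄).toReal - (K x₃).toReal) / (x₄ - x₃) ≤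
      ((K x₃).toReal - (K x₂).toReal) / (x₃ - x₂) := by
    intro hb
    rcases h4.eq_or_lt with rfl | h4
    · exact hK.concave_neg.slope_anti_adjacent_right_endpoint
        ((EReal.tendsto_toReal (hK.ne_top 0) hb).comp hK.lim_zero_left) m2.1 h23 h34
    · exact hK.concave_neg.slope_anti_adjacent m2 ⟨by linarith, h4⟩ h23 h34
  refine weighted_sum_le_and_lt_of_slopes hK.ne_top hp hq h12 h34 hpq
    (hK.finite_off_zero _ ⟨m2.1, by linarith⟩ m2.2.ne)
    (hK.finite_off_zero _ ⟨m3.1, by linarith⟩ m3.2.ne)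
    (fun _ hb => (outer hb).trans (hK.concave_neg.slope_anti_adjacent m1 m3 h12 h23))
    (fun hs _ hb => (outer hb).trans_lt (hs.1.slope_anti_adjacent m1 m3 h12 h23))

/-- The weighted comparison for a kernel at points of `[0, 1)`. -/
theorem IsKernel.weighted_sum_le_and_lt_pos {K : ℝ → EReal} (hK : IsKernel K)
    {p q x₁ x₂ x₃ x₄ : ℝ} (hp : 0 < p) (hq : 0 < q) (h1 : 0 ≤ x₁) (h12 : x₁ < x₂)
    (h23 : x₂ < x₃) (h34 : x₃ < x₄) (h4 : x₄ < 1) (hpq : p * (x₄ - x₃) = q * (x₂ - x₁)) :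
    (p : EReal) * K x₄ + (q : EReal) * K x₁ ≤ (p : EReal) * K x₃ + (q : EReal) * K x₂ ∧
    (StrictConcaveKernel K → (p : EReal) * K x₄ + (q : EReal) * K x₁ <
      (p : EReal) * K x₃ + (q : EReal) * K x₂) := by
  have m2 : x₂ ∈ Ioo (0 : ℝ) 1 := ⟨by linarith, by linarith⟩
  have m3 : x₃ ∈ Ioo (0 : ℝ) 1 := ⟨by linarith, by linarith⟩
  have m4 : x₄ ∈ Ioo (0 : ℝ) 1 := ⟨by linarith, h4⟩
  have outer : K x₁ ≠ ⊥ → ((K x₃).toReal - (K x₂).toReal) / (x₃ - x₂) ≤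
      ((K x₂).toReal - (K x₁).toReal) / (x₂ - x₁) := by
    intro hb
    rcases h1.eq_or_lt with rfl | h1
    · exact hK.concave_pos.slope_anti_adjacent_left_endpoint
        ((EReal.tendsto_toReal (hK.ne_top 0) hb).comp hK.lim_zero_right) h12 h23 m3.2
    · exact hK.concave_pos.slope_anti_adjacent ⟨h1, by linarith⟩ m3 h12 h23
  refine weighted_sum_le_and_lt_of_slopes hK.ne_top hp hq h12 h34 hpq
    (hK.finite_off_zero _ ⟨by linarith [m2.1], m2.2⟩ m2.1.ne')
    (hK.finite_off_zero _ ⟨by linarith [m3.1], m3.2⟩ m3.1.ne')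
    (fun hb _ => (hK.concave_pos.slope_anti_adjacent m2 m4 h23 h34).trans (outer hb))
    (fun hs hb _ => (hs.2.slope_anti_adjacent m2 m4 h23 h34).trans_le (outer hb))

theorem statement4 (K : ℝ → EReal) (hK : IsKernel K)
    (α a b β : ℝ) (h0 : 0 < α) (h1 : α < a) (h2 : a < b) (h3 : b < β) (h4 : β < 1)
    (p q : ℝ) (hp : 0 < p) (hq : 0 < q)
    (hμ : p * (a - α) / (q * (β - b)) = 1) :
    (∀ t ∈ Icc (0:ℝ) α ∪ Icc β (1:ℝ),
      (p : EReal) * K (t - α) + (q : EReal) * K (t - β) ≤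
        (p : EReal) * K (t - a) + (q : EReal) * K (t - b)) ∧
    (StrictConcaveKernel K → ∀ t ∈ Icc (0:ℝ) α ∪ Icc β (1:ℝ),
      (p : EReal) * K (t - α) + (q : EReal) * K (t - β) <
        (p : EReal) * K (t - a) + (q : EReal) * K (t - b)) := by
  have hpq : p * (a - α) = q * (β - b) :=
    (div_eq_one_iff_eq (mul_pos hq (sub_pos.2 h3)).ne').1 hμ
  have main : ∀ t ∈ Icc (0:ℝ) α ∪ Icc β (1:ℝ),
      (p : EReal) * K (t - α) + (q : EReal) * K (t - β) ≤
        (p : EReal) * K (t - a) + (q : EReal) * K (t - b) ∧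
      (StrictConcaveKernel K → (p : EReal) * K (t - α) + (q : EReal) * K (t - β) <
        (p : EReal) * K (t - a) + (q : EReal) * K (t - b)) := by
    rintro t (⟨ht0, htα⟩ | ⟨htβ, ht1⟩)
    · exact hK.weighted_sum_le_and_lt_neg hp hq (by linarith) (by linarith) (by linarith)
        (by linarith) (by linarith) (by linear_combination hpq)
    · exact hK.weighted_sum_le_and_lt_pos hp hq (by linarith) (by linarith) (by linarith)
        (by linarith) (by linarith) (by linear_combination hpq)
  exact ⟨fun t ht => (main t ht).1, fun hs t ht => (main t ht).2 hs⟩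
end
end
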